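/- arXiv:2210.08740 — 12 statements merged into one kernel-verified Lean document; each statement's English description precedes it below -/
import Mathlib

section
/- Let X be an integrable real random variable on a probability space, let α ∈ (0,1), and let q := inf{y ∈ ℝ : P(X ≤ y) ≥ α} be the α-quantile (VaR) of X. Then q minimizes the Rockafellar–Uryasev objective: for every y ∈ ℝ, q + (1-α)⁻¹·E[max(X - q, 0)] ≤ y + (1-α)⁻¹·E[max(X - y, 0)]. -/
open MeasureTheory

open Filter ProbabilityTheory in
/-- The infimum defining the quantile is attained. -/
theorem le_cdf_sInf (ν : Measure ℝ) {α : ℝ} (h0 : 0 < α) (h1 : α < 1) :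
    α ≤ cdf ν (sInf {y | α ≤ cdf ν y}) := by
  obtain ⟨a, ha⟩ := ((tendsto_cdf_atBot ν).eventually (gt_mem_nhds h0)).exists
  obtain ⟨b, hb⟩ := ((tendsto_cdf_atTop ν).eventually (lt_mem_nhds h1)).exists
  have hne : {y | α ≤ cdf ν y}.Nonempty := ⟨b, hb.le⟩
  set q := sInf {y | α ≤ cdf ν y}
  have hright : Tendsto (cdf ν) (nhdsWithin q (Set.Ioi q)) (nhds (cdf ν q)) :=
    ((cdf ν).right_continuous q).mono_left (nhdsWithin_mono q Set.Ioi_subset_Ici_self)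
  refine ge_of_tendsto hright ?_
  filter_upwards [self_mem_nhdsWithin] with y hy
  obtain ⟨z, hz, hzy⟩ := exists_lt_of_csInf_lt hne hy
  exact le_trans hz (monotone_cdf ν hzy.le)

open Filter ProbabilityTheory in
/-- The mass strictly below the `α`-quantile is at most `α`. -/
theorem measureReal_Iio_sInf_cdf_le (ν : Measure ℝ) [IsProbabilityMeasure ν] {α : ℝ}
    (h0 : 0 < α) : ν.real (Set.Iio (sInf {y | α ≤ cdf ν y})) ≤ α := by
  obtain ⟨a, ha⟩ := ((tendsto_cdf_atBot ν).eventually (gt_mem_nhds h0)).exists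
  have hbdd : BddBelow {y | α ≤ cdf ν y} :=
    ⟨a, fun y hy => le_of_not_gt fun hya =>
      (ha.trans_le hy).not_ge (monotone_cdf ν hya.le)⟩
  set q := sInf {y | α ≤ cdf ν y}
  have hlim : Function.leftLim (cdf ν) q ≤ α := by
    refine le_of_tendsto ((monotone_cdf ν).tendsto_leftLim q) ?_
    filter_upwards [self_mem_nhdsWithin] with y hy
    exact (not_le.mp fun h => notMem_of_lt_csInf hy hbdd h).le
  have hIio := (cdf ν).measure_Iio (tendsto_cdf_atBot ν) q
  rw [measure_cdf, sub_zero] at hIio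
  rw [measureReal_def, hIio]
  exact ENNReal.toReal_le_of_le_ofReal h0.le (ENNReal.ofReal_le_ofReal hlim)

/-- The probability of any event between `{q < X}` and `{q ≤ X}` gives a subgradient at `q` of
`y ↦ 𝔼[max (X - y) 0]`. -/
theorem integral_max_sub_add_le {Ω : Type*} [MeasurableSpace Ω] {μ : Measure Ω}
    [IsFiniteMeasure μ] {X : Ω → ℝ} (hX : Integrable X μ) {q : ℝ} {s : Set Ω}
    (hs : MeasurableSet s) (hgt : ∀ ω, q < X ω → ω ∈ s) (hge : ∀ ω ∈ s, q ≤ X ω) (y : ℝ) :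
    ∫ ω, max (X ω - q) 0 ∂μ + (q - y) * μ.real s ≤ ∫ ω, max (X ω - y) 0 ∂μ := by
  have hint (c : ℝ) : Integrable (fun ω => max (X ω - c) 0) μ :=
    (hX.sub (integrable_const c)).pos_part
  have hind : Integrable (s.indicator fun _ => q - y) μ := (integrable_const _).indicator hs
  have heq : (q - y) * μ.real s = ∫ ω, s.indicator (fun _ => q - y) ω ∂μ := by
    rw [integral_indicator_const _ hs, smul_eq_mul, mul_comm]
  rw [heq, ← integral_add (hint q) hind]
  refine integral_mono ((hint q).add hind) (hint y) fun ω => ?_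
  by_cases hω : ω ∈ s
  · have h := hge ω hω
    simp [hω, max_eq_left (sub_nonneg.mpr h)]
  · have h := not_lt.mp (mt (hgt ω) hω)
    simp [hω, max_eq_right (sub_nonpos.mpr h)]

/-- The α-quantile (VaR) minimizes the Rockafellar–Uryasev objective. -/
theorem var_minimizes_rockafellar_uryasev
    {Ω : Type*} [MeasurableSpace Ω] (μ : Measure Ω) [IsProbabilityMeasure μ]
    (X : Ω → ℝ) (hXm : Measurable X) (hX : Integrable X μ)
    (α : ℝ) (hα : α ∈ Set.Ioo (0 : ℝ) 1)
    (q : ℝ) (hq : q = sInf {y : ℝ | α ≤ (μ {ω | X ω ≤ y}).toReal}) :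
    ∀ y : ℝ,
      q + (1 - α)⁻¹ * ∫ ω, max (X ω - q) 0 ∂μ ≤
        y + (1 - α)⁻¹ * ∫ ω, max (X ω - y) 0 ∂μ := by
  intro y
  obtain ⟨h0, h1⟩ := hα
  have : IsProbabilityMeasure (μ.map X) := Measure.isProbabilityMeasure_map hXm.aemeasurable
  have hcdf (z : ℝ) : ProbabilityTheory.cdf (μ.map X) z = (μ {ω | X ω ≤ z}).toReal := by
    rw [ProbabilityTheory.cdf_eq_real, map_measureReal_apply hXm measurableSet_Iic]
    rfl
  simp_rw [← hcdf] at hq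
  have hle := le_cdf_sInf (μ.map X) h0 h1
  have hlt := measureReal_Iio_sInf_cdf_le (μ.map X) h0
  rw [← hq] at hle hlt
  rw [ProbabilityTheory.cdf_eq_real, map_measureReal_apply hXm measurableSet_Iic] at hle
  rw [map_measureReal_apply hXm measurableSet_Iio] at hlt
  have hsub : (q - y) * (1 - α) ≤
      ∫ ω, max (X ω - y) 0 ∂μ - ∫ ω, max (X ω - q) 0 ∂μ := by
    rcases le_total q y with hqy | hyq
    · have hs := hXm (measurableSet_Iic (a := q))
      have h := integral_max_sub_add_le hX hs.compl (q := q)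
        (fun ω hω => not_le.mpr hω) (fun ω hω => le_of_not_ge hω) y
      rw [probReal_compl_eq_one_sub hs] at h
      nlinarith
    · have hs := hXm (measurableSet_Iio (a := q))
      have h := integral_max_sub_add_le hX hs.compl (q := q)
        (fun ω hω => not_lt.mpr hω.le) (fun ω hω => not_lt.mp hω) y
      rw [probReal_compl_eq_one_sub hs] at h
      nlinarith
  have hdiv := (le_div_iff₀ (sub_pos.mpr h1)).mpr hsub
  rw [div_eq_inv_mul, mul_sub] at hdiv
  linarith
end

section
/- Let X be an integrable real random variable, α ∈ (0,1), and q := inf{y ∈ ℝ : P(X ≤ y) ≥ α}. If P(X ≤ q) = α and P(X = q) = 0, then the minimal value of the Rockafellar–Uryasev objective equals the conditional expectation of X above its α-quantile: q + (1-α)⁻¹·E[max(X - q, 0)] = (1-α)⁻¹·E[X·1{X ≥ q}], and moreover P(X ≥ q) = 1-α, so this value equals E[X | X ≥ q]. -/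
open MeasureTheory

/-- The expected excess of `X` over `q`, split into the tail expectation and the tail mass. -/
theorem integral_max_sub_zero_eq {Ω : Type*} [MeasurableSpace Ω] {μ : Measure Ω}
    [IsFiniteMeasure μ] {X : Ω → ℝ} (hXm : Measurable X) (hX : Integrable X μ) (q : ℝ) :
    ∫ ω, max (X ω - q) 0 ∂μ
      = ∫ ω in {ω | q ≤ X ω}, X ω ∂μ - μ.real {ω | q ≤ X ω} * q := by
  have hs : MeasurableSet {ω | q ≤ X ω} := measurableSet_le measurable_const hXm
  have hmax : (fun ω => max (X ω - q) 0) = {ω | q ≤ X ω}.indicator fun ω => X ω - q := by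
    ext ω
    by_cases h : q ≤ X ω
    · simp [h]
    · simp [h, (not_le.mp h).le]
  rw [hmax, integral_indicator hs,
    integral_sub hX.integrableOn (integrable_const q), setIntegral_const, smul_eq_mul]

/-- If `X` has no atom at `q`, then `P(X ≥ q) = 1 - P(X ≤ q)`. -/
theorem measureReal_le_eq_one_sub {Ω : Type*} [MeasurableSpace Ω] {μ : Measure Ω}
    [IsProbabilityMeasure μ] {X : Ω → ℝ} (hXm : Measurable X) {q : ℝ}
    (hq : μ {ω | X ω = q} = 0) :
    μ.real {ω | q ≤ X ω} = 1 - μ.real {ω | X ω ≤ q} := by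
  have hs : MeasurableSet {ω | X ω ≤ q} := measurableSet_le hXm measurable_const
  rw [← probReal_compl_eq_one_sub hs]
  refine measureReal_congr ?_
  have hne : ∀ᵐ ω ∂μ, X ω ≠ q := by simpa [ae_iff] using hq
  filter_upwards [hne] with ω hω
  exact propext ⟨fun h => not_le.mpr (lt_of_le_of_ne h hω.symm),
    fun h : ¬X ω ≤ q => (not_le.mp h).le⟩

/-- Under continuity conditions at the quantile, the minimal value of the
Rockafellar–Uryasev objective equals the conditional expectation of `X` above its
α-quantile, and `P(X ≥ q) = 1 - α`. -/
theorem rockafellar_uryasev_min_eq_cvar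
    {Ω : Type*} [MeasurableSpace Ω] (μ : Measure Ω) [IsProbabilityMeasure μ]
    (X : Ω → ℝ) (hXm : Measurable X) (hX : Integrable X μ)
    (α : ℝ) (hα : α ∈ Set.Ioo (0 : ℝ) 1)
    (q : ℝ) (hq : q = sInf {y : ℝ | α ≤ (μ {ω | X ω ≤ y}).toReal})
    (h1 : (μ {ω | X ω ≤ q}).toReal = α)
    (h2 : μ {ω | X ω = q} = 0) :
    q + (1 - α)⁻¹ * ∫ ω, max (X ω - q) 0 ∂μ
        = (1 - α)⁻¹ * ∫ ω in {ω | q ≤ X ω}, X ω ∂μ ∧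
    (μ {ω | q ≤ X ω}).toReal = 1 - α ∧
    q + (1 - α)⁻¹ * ∫ ω, max (X ω - q) 0 ∂μ
        = (∫ ω in {ω | q ≤ X ω}, X ω ∂μ) / (μ {ω | q ≤ X ω}).toReal := by
  have hP : μ.real {ω | q ≤ X ω} = 1 - α := by
    rw [measureReal_le_eq_one_sub hXm h2, measureReal_def, h1]
  have hα' : 1 - α ≠ 0 := (sub_pos.mpr hα.2).ne'
  have hmain : q + (1 - α)⁻¹ * ∫ ω, max (X ω - q) 0 ∂μ
      = (1 - α)⁻¹ * ∫ ω in {ω | q ≤ X ω}, X ω ∂μ := by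
    rw [integral_max_sub_zero_eq hXm hX, hP]
    field_simp
    ring
  refine ⟨hmain, hP, ?_⟩
  rw [hmain, ← measureReal_def, hP, inv_mul_eq_div]
end

section
/- Performance difference formula: let S be a finite nonempty set, let P, P' : S × S → ℝ be row-stochastic matrices (entries nonnegative, each row summing to 1), let c, c' : S → ℝ be cost vectors, let η ∈ ℝ, and let g : S → ℝ satisfy the Poisson equation g(i) = c(i) - η + Σ_{j∈S} P(i,j)·g(j) for all i. Let π' : S → ℝ be a probability vector (π'(i) ≥ 0, Σ_i π'(i) = 1) that is stationary for P', i.e. Σ_{i∈S} π'(i)·P'(i,j) = π'(j) for all j, and set η' := Σ_{i∈S} π'(i)·c'(i). Then η' - η = Σ_{i∈S} π'(i)·[ Σ_{j∈S} (P'(i,j) - P(i,j))·g(j) + c'(i) - c(i) ]. -/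
/-- Performance difference formula for long-run average MDPs. -/
theorem performance_difference_formula
    {S : Type*} [Fintype S] [Nonempty S]
    (P P' : S → S → ℝ)
    (hP0 : ∀ i j, 0 ≤ P i j) (hP1 : ∀ i, ∑ j, P i j = 1)
    (hP'0 : ∀ i j, 0 ≤ P' i j) (hP'1 : ∀ i, ∑ j, P' i j = 1)
    (c c' : S → ℝ) (η : ℝ) (g : S → ℝ)
    (hg : ∀ i, g i = c i - η + ∑ j, P i j * g j)
    (π' : S → ℝ) (hπ'0 : ∀ i, 0 ≤ π' i) (hπ'1 : ∑ i, π' i = 1)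
    (hπ'stat : ∀ j, ∑ i, π' i * P' i j = π' j)
    (η' : ℝ) (hη' : η' = ∑ i, π' i * c' i) :
    η' - η = ∑ i, π' i * ((∑ j, (P' i j - P i j) * g j) + c' i - c i) := by
  have stationary_mean : ∑ i, π' i * ∑ j, P' i j * g j = ∑ j, π' j * g j := by
    simp_rw [Finset.mul_sum, ← mul_assoc]
    rw [Finset.sum_comm]
    simp_rw [← Finset.sum_mul, hπ'stat]
  have summand_eq (i : S) : π' i * ((∑ j, (P' i j - P i j) * g j) + c' i - c i) =
      π' i * (∑ j, P' i j * g j) - π' i * g i - π' i * η + π' i * c' i := by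
    simp_rw [sub_mul, Finset.sum_sub_distrib]
    linear_combination π' i * hg i
  simp_rw [summand_eq, Finset.sum_add_distrib, Finset.sum_sub_distrib]
  rw [stationary_mean, ← Finset.sum_mul, hπ'1, hη']
  ring
end

section
/- Solvability of the Poisson equation: let S be a finite nonempty set, P : S × S → ℝ a row-stochastic matrix, and π a stationary probability vector for P such that every row vector v : S → ℝ with Σ_i v(i)P(i,j) = v(j) for all j is a scalar multiple of π. Then for every cost vector c : S → ℝ there exists g : S → ℝ satisfying g(i) = c(i) - Σ_{j∈S} π(j)·c(j) + Σ_{j∈S} P(i,j)·g(j) for all i ∈ S. -/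
/-- The Fredholm alternative for a matrix over a field. -/
theorem Matrix.exists_mulVec_eq_of_forall_vecMul_eq_zero {m n K : Type*} [Fintype m] [Fintype n]
    [Field K] (A : Matrix m n K) (b : m → K)
    (h : ∀ v : m → K, Matrix.vecMul v A = 0 → v ⬝ᵥ b = 0) :
    ∃ x : n → K, A.mulVec x = b := by
  classical
  by_contra hb
  have hb' : b ∉ LinearMap.range A.mulVecLin := fun ⟨x, hx⟩ ↦ hb ⟨x, by simpa using hx⟩
  obtain ⟨f, hfb, hf⟩ := Submodule.exists_le_ker_of_notMem hb'
  obtain ⟨v, rfl⟩ := (dotProductEquiv K m).surjective f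
  refine hfb (h v (dotProduct_eq_zero _ fun x ↦ ?_))
  rw [← Matrix.dotProduct_mulVec]
  exact hf ⟨x, rfl⟩

/-- Solvability of the Poisson equation when the stationary row vector of
`P` is unique up to scalar multiples. -/
theorem poisson_equation_solvable
    {S : Type*} [Fintype S] [Nonempty S]
    (P : S → S → ℝ)
    (hP0 : ∀ i j, 0 ≤ P i j) (hP1 : ∀ i, ∑ j, P i j = 1)
    (π : S → ℝ) (hπ0 : ∀ i, 0 ≤ π i) (hπ1 : ∑ i, π i = 1)
    (hπstat : ∀ j, ∑ i, π i * P i j = π j)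
    (huniq : ∀ v : S → ℝ, (∀ j, ∑ i, v i * P i j = v j) → ∃ t : ℝ, v = t • π)
    (c : S → ℝ) :
    ∃ g : S → ℝ, ∀ i, g i = c i - (∑ j, π j * c j) + ∑ j, P i j * g j := by
  classical
  obtain ⟨g, hg⟩ := Matrix.exists_mulVec_eq_of_forall_vecMul_eq_zero (1 - Matrix.of P)
    (fun i ↦ c i - ∑ j, π j * c j) fun v hv ↦ by
      rw [Matrix.vecMul_sub, Matrix.vecMul_one, sub_eq_zero] at hv
      obtain ⟨t, rfl⟩ := huniq v fun j ↦ (congrFun hv j).symm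
      rw [smul_dotProduct]
      simp [dotProduct, mul_sub, Finset.sum_sub_distrib, ← Finset.sum_mul, hπ1]
  refine ⟨g, fun i ↦ sub_eq_iff_eq_add.mp ?_⟩
  rw [Matrix.sub_mulVec, Matrix.one_mulVec] at hg
  exact congrFun hg i
end

section
/- Bilevel reformulation with a finite outer set: for every deterministic policy d, the infimum defining CVaR^d is attained at y = VaR^d, and VaR^d lies in the finite set C := {c(i,a) : i ∈ S, a ∈ A}. Consequently, the minimum of CVaR^d over all deterministic policies d equals min_{y ∈ C} min_{d} ṼC^d(y), where both minima on the right are over the finite sets C and the set of deterministic policies. -/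
/-- The pseudo-CVaR cost `c̃(y,i,a) = y + (1-α)⁻¹ max(c(i,a) - y, 0)`. -/
noncomputable def ctil {S A : Type*} (α : ℝ) (c : S → A → ℝ) (y : ℝ) (i : S) (a : A) : ℝ :=
  y + (1 - α)⁻¹ * max (c i a - y) 0

/-- The pseudo CVaR `ṼC^d(y) = Σ_i π(i) c̃(y,i,d(i))` of a deterministic policy `d`
with stationary distribution `π`. -/
noncomputable def pC {S A : Type*} [Fintype S] (α : ℝ) (c : S → A → ℝ) (π : S → ℝ)
    (d : S → A) (y : ℝ) : ℝ :=
  ∑ i, π i * ctil α c y i (d i)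

/-- The long-run CVaR `CVaR^d = inf_{y ∈ ℝ} ṼC^d(y)`. -/
noncomputable def CV {S A : Type*} [Fintype S] (α : ℝ) (c : S → A → ℝ) (π : S → ℝ)
    (d : S → A) : ℝ :=
  sInf (Set.range (pC α c π d))

/-- The long-run VaR `VaR^d = inf {w : Σ_{i : c(i,d(i)) ≤ w} π(i) ≥ α}`. -/
noncomputable def VaR {S A : Type*} [Fintype S] (α : ℝ) (c : S → A → ℝ) (π : S → ℝ)
    (d : S → A) : ℝ :=
  sInf {w : ℝ | α ≤ ∑ i, if c i (d i) ≤ w then π i else 0}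

section Quantile

variable {ι : Type*} [Fintype ι]

/-- The maximiser of `X` over a set of mass at least `α` is a value whose lower level set has mass
at least `α`. -/
lemma exists_mem_le_mass_lowerLevel {α : ℝ} {w X : ι → ℝ} (hα : 0 < α) (hw : ∀ i, 0 ≤ w i)
    {s : Finset ι} (hs : α ≤ ∑ i ∈ s, w i) :
    ∃ i ∈ s, α ≤ ∑ j, if X j ≤ X i then w j else 0 := by
  have hne : s.Nonempty := by
    rw [Finset.nonempty_iff_ne_empty]
    rintro rfl
    simp only [Finset.sum_empty] at hs
    linarith
  obtain ⟨i, hi, hmax⟩ := s.exists_max_image X hne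
  refine ⟨i, hi, hs.trans ?_⟩
  rw [← Finset.sum_filter]
  exact Finset.sum_le_sum_of_subset_of_nonneg
    (fun j hj ↦ Finset.mem_filter.2 ⟨Finset.mem_univ j, hmax j hj⟩) fun j _ _ ↦ hw j

/-- The lower `α`-quantile of a finitely supported distribution is attained at a value of `X`. -/
lemma exists_isLeast_quantile {α : ℝ} {w X : ι → ℝ} (hα : 0 < α) (hα1 : α ≤ 1)
    (hw : ∀ i, 0 ≤ w i) (hw1 : ∑ i, w i = 1) :
    ∃ i, IsLeast {t : ℝ | α ≤ ∑ j, if X j ≤ t then w j else 0} (X i) := by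
  obtain ⟨i₀, -, hi₀⟩ := exists_mem_le_mass_lowerLevel (X := X) (s := Finset.univ) hα hw
    (by rwa [hw1])
  obtain ⟨i, hi, hmin⟩ := Finset.exists_min_image
    (Finset.univ.filter fun i ↦ α ≤ ∑ j, if X j ≤ X i then w j else 0) X
    ⟨i₀, by simpa using hi₀⟩
  refine ⟨i, (Finset.mem_filter.1 hi).2, fun t ht ↦ ?_⟩
  rw [Set.mem_ofPred_eq, ← Finset.sum_filter] at ht
  obtain ⟨k, hk, hkα⟩ := exists_mem_le_mass_lowerLevel (X := X) hα hw ht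
  exact (hmin k (Finset.mem_filter.2 ⟨Finset.mem_univ k, hkα⟩)).trans (Finset.mem_filter.1 hk).2

/-- The mass strictly below the lower `α`-quantile is less than `α`. -/
lemma mass_lt_of_isLeast_quantile {α v : ℝ} {w X : ι → ℝ} (hα : 0 < α) (hw : ∀ i, 0 ≤ w i)
    (hv : IsLeast {t : ℝ | α ≤ ∑ j, if X j ≤ t then w j else 0} v) :
    (∑ j, if X j < v then w j else 0) < α := by
  by_contra! h
  rw [← Finset.sum_filter] at h
  obtain ⟨k, hk, hkα⟩ := exists_mem_le_mass_lowerLevel (X := X) hα hw h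
  exact (hv.2 hkα).not_gt (Finset.mem_filter.1 hk).2

/-- The lower `α`-quantile minimises the Rockafellar–Uryasev function. -/
lemma add_sum_max_le_of_isLeast_quantile {α v : ℝ} {w X : ι → ℝ} (hα : 0 < α) (hα1 : α < 1)
    (hw : ∀ i, 0 ≤ w i) (hw1 : ∑ i, w i = 1)
    (hv : IsLeast {t : ℝ | α ≤ ∑ j, if X j ≤ t then w j else 0} v) (y : ℝ) :
    v + (1 - α)⁻¹ * ∑ i, w i * max (X i - v) 0 ≤ y + (1 - α)⁻¹ * ∑ i, w i * max (X i - y) 0 := by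
  have h1 : 0 < 1 - α := by linarith
  suffices h : (1 - α) * (v - y) + ∑ i, w i * max (X i - v) 0 ≤ ∑ i, w i * max (X i - y) 0 by
    have := mul_le_mul_of_nonneg_left h (inv_nonneg.2 h1.le)
    rw [mul_add, inv_mul_cancel_left₀ h1.ne'] at this
    linarith
  rcases le_total v y with hy | hy
  · have key : ∑ i, w i * max (X i - v) 0 ≤
        ∑ i, (w i * max (X i - y) 0 + (y - v) * (w i - if X i ≤ v then w i else 0)) := by
      refine Finset.sum_le_sum fun i _ ↦ ?_
      split_ifs with h
      · rw [max_eq_right (by linarith : X i - v ≤ 0)]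
        have := mul_nonneg (hw i) (le_max_right (X i - y) 0)
        linarith
      · rw [max_eq_left (by linarith : 0 ≤ X i - v)]
        have := mul_le_mul_of_nonneg_left (le_max_left (X i - y) 0) (hw i)
        linarith
    rw [Finset.sum_add_distrib, ← Finset.mul_sum, Finset.sum_sub_distrib, hw1] at key
    have := mul_le_mul_of_nonneg_left hv.1 (sub_nonneg.2 hy)
    linarith
  · have key : ∑ i, (w i * max (X i - v) 0 + (v - y) * (w i - if X i < v then w i else 0)) ≤
        ∑ i, w i * max (X i - y) 0 := by
      refine Finset.sum_le_sum fun i _ ↦ ?_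
      split_ifs with h
      · rw [max_eq_right (by linarith : X i - v ≤ 0)]
        have := mul_nonneg (hw i) (le_max_right (X i - y) 0)
        linarith
      · rw [max_eq_left (by linarith : 0 ≤ X i - v)]
        have := mul_le_mul_of_nonneg_left (le_max_left (X i - y) 0) (hw i)
        linarith
    rw [Finset.sum_add_distrib, ← Finset.mul_sum, Finset.sum_sub_distrib, hw1] at key
    have := mul_le_mul_of_nonneg_left (mass_lt_of_isLeast_quantile hα hw hv).le (sub_nonneg.2 hy)
    linarith

end Quantile

lemma pC_eq_add_sum {S A : Type*} [Fintype S] (α : ℝ) (c : S → A → ℝ) {π : S → ℝ}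
    (hπ1 : ∑ i, π i = 1) (d : S → A) (y : ℝ) :
    pC α c π d y = y + (1 - α)⁻¹ * ∑ i, π i * max (c i (d i) - y) 0 := by
  simp only [pC, ctil, mul_add, Finset.sum_add_distrib, ← Finset.sum_mul, hπ1, one_mul,
    Finset.mul_sum, mul_left_comm]

/-- Bilevel reformulation with a finite outer set: for every deterministic
policy the infimum defining `CVaR^d` is attained at `VaR^d`, which lies in the finite set
`C = {c(i,a)}`, and `min_d CVaR^d = min_{y ∈ C} min_d ṼC^d(y)`. -/
theorem cvar_bilevel_finite_outer_set
    {S A : Type*} [Fintype S] [Fintype A] [Nonempty S] [Nonempty A]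
    (p : S → A → S → ℝ) (hp0 : ∀ i a j, 0 ≤ p i a j) (hp1 : ∀ i a, ∑ j, p i a j = 1)
    (c : S → A → ℝ) (α : ℝ) (hα : α ∈ Set.Ioo (0 : ℝ) 1)
    (sd : (S → A) → S → ℝ)
    (hsd0 : ∀ d i, 0 ≤ sd d i) (hsd1 : ∀ d, ∑ i, sd d i = 1)
    (hsdstat : ∀ (d : S → A) (j : S), ∑ i, sd d i * p i (d i) j = sd d j) :
    (∀ d : S → A,
        CV α c (sd d) d = pC α c (sd d) d (VaR α c (sd d) d) ∧
        VaR α c (sd d) d ∈ Set.range (fun q : S × A => c q.1 q.2)) ∧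
    (⨅ d : S → A, CV α c (sd d) d) =
      ⨅ q : S × A, ⨅ d : S → A, pC α c (sd d) d (c q.1 q.2) := by
  obtain ⟨hα0, hα1⟩ := hα
  have hvar (d : S → A) : ∃ i, IsLeast
      {t : ℝ | α ≤ ∑ j, if c j (d j) ≤ t then sd d j else 0} (c i (d i)) :=
    exists_isLeast_quantile (X := fun i ↦ c i (d i)) hα0 hα1.le (hsd0 d) (hsd1 d)
  have hmem (d : S → A) : ∃ i, VaR α c (sd d) d = c i (d i) :=
    (hvar d).imp fun _ hi ↦ hi.csInf_eq
  have hmin (d : S → A) : IsLeast (Set.range (pC α c (sd d) d))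
      (pC α c (sd d) d (VaR α c (sd d) d)) := by
    refine ⟨Set.mem_range_self _, ?_⟩
    rintro _ ⟨y, rfl⟩
    obtain ⟨i, hi⟩ := hvar d
    rw [show VaR α c (sd d) d = c i (d i) from hi.csInf_eq, pC_eq_add_sum α c (hsd1 d),
      pC_eq_add_sum α c (hsd1 d)]
    exact add_sum_max_le_of_isLeast_quantile (X := fun i ↦ c i (d i)) hα0 hα1 (hsd0 d) (hsd1 d)
      hi y
  have hCV (d : S → A) : CV α c (sd d) d = pC α c (sd d) d (VaR α c (sd d) d) :=
    (hmin d).csInf_eq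
  refine ⟨fun d ↦ ⟨hCV d, ?_⟩, le_antisymm ?_ ?_⟩
  · obtain ⟨i, hi⟩ := hmem d
    exact ⟨(i, d i), hi.symm⟩
  · refine le_ciInf fun q ↦ le_ciInf fun d ↦ ?_
    refine (ciInf_le (Set.finite_range _).bddBelow d).trans ?_
    rw [hCV d]
    exact (hmin d).2 (Set.mem_range_self _)
  · refine le_ciInf fun d ↦ ?_
    obtain ⟨i, hi⟩ := hmem d
    rw [hCV d, hi]
    exact (ciInf_le (Set.finite_range _).bddBelow (i, d i)).trans
      (ciInf_le (Set.finite_range _).bddBelow d)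
end

section
/- Optimality of deterministic policies: suppose that for every stationary randomized policy d the transition matrix P^d has a unique stationary probability vector π^d and π^d(i) > 0 for all i ∈ S. Then there exists a deterministic policy d₀ : S → A such that, viewing d₀ as the randomized policy putting probability 1 on action d₀(i) at each state i, CVaR^{d₀} ≤ CVaR^{d} for every stationary randomized policy d; that is, the minimum of the long-run CVaR over all stationary randomized policies is achieved by a deterministic stationary policy. -/
/-- The long-run CVaR of a stationary randomized policy `d` with stationary state
distribution `π`: `inf_{y} Σ_{i,a} π(i) d(i,a) c̃(y,i,a)`. -/
noncomputable def CVrand {S A : Type*} [Fintype S] [Fintype A] (α : ℝ) (c : S → A → ℝ)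
    (π : S → ℝ) (d : S → A → ℝ) : ℝ :=
  sInf (Set.range (fun y : ℝ => ∑ i, ∑ a, π i * d i a * ctil α c y i a))

/-- The deterministic policy `d₀` viewed as a randomized policy. -/
noncomputable def detPolicy {S A : Type*} [DecidableEq A] (d₀ : S → A) : S → A → ℝ :=
  fun i a => if a = d₀ i then 1 else 0

open Finset in
/-- A stationary probability vector that is positive everywhere and unique among probability
vectors spans the stationary signed vectors: a stationary vector of total mass zero vanishes. -/
theorem eq_zero_of_stationary_of_sum_eq_zero {S : Type*} [Fintype S] {P : S → S → ℝ} {π : S → ℝ}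
    (hpos : ∀ i, 0 < π i) (hsum : ∑ i, π i = 1) (hstat : ∀ j, ∑ i, π i * P i j = π j)
    (huniq : ∀ w : S → ℝ, (∀ i, 0 ≤ w i) → ∑ i, w i = 1 → (∀ j, ∑ i, w i * P i j = w j) → w = π)
    {v : S → ℝ} (hv : ∀ j, ∑ i, v i * P i j = v j) (hv0 : ∑ i, v i = 0) : v = 0 := by
  set t : ℝ := 1 + ∑ k, |v k| / π k with ht
  have hterm : ∀ k, 0 ≤ |v k| / π k := fun k => div_nonneg (abs_nonneg _) (hpos k).le
  have htpos : 0 < t := by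
    have := sum_nonneg fun k (_ : k ∈ univ) => hterm k
    linarith
  have hbound : ∀ k, |v k| ≤ t * π k := fun k => by
    rw [← div_le_iff₀ (hpos k)]
    have := single_le_sum (fun k _ => hterm k) (mem_univ k)
    linarith
  have hw := huniq (fun i => π i + t⁻¹ * v i)
    (fun i => by
      have h := mul_le_mul_of_nonneg_left (hbound i) (inv_pos.2 htpos).le
      rw [inv_mul_cancel_left₀ htpos.ne'] at h
      have h' := mul_le_mul_of_nonneg_left (neg_abs_le (v i)) (inv_pos.2 htpos).le
      linarith)
    (by rw [sum_add_distrib, ← mul_sum, hv0, hsum]; ring)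
    (fun j => by
      simp only [add_mul, sum_add_distrib, mul_assoc, ← mul_sum, hstat, hv])
  funext i
  have := congrFun hw i
  simpa [htpos.ne'] using this

open Finset in
/-- Solvability of the Poisson equation of a stochastic matrix whose stationary probability vector
is unique and positive. -/
theorem exists_poisson_solution {S : Type*} [Fintype S] {P : S → S → ℝ} {π : S → ℝ}
    (hP : ∀ i, ∑ j, P i j = 1)
    (hpos : ∀ i, 0 < π i) (hsum : ∑ i, π i = 1) (hstat : ∀ j, ∑ i, π i * P i j = π j)
    (huniq : ∀ w : S → ℝ, (∀ i, 0 ≤ w i) → ∑ i, w i = 1 → (∀ j, ∑ i, w i * P i j = w j) → w = π)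
    (f : S → ℝ) : ∃ (g : ℝ) (h : S → ℝ), ∀ i, f i + ∑ j, P i j * h j - h i = g := by
  classical
  let M : Matrix S S ℝ := 1 - Matrix.of P + Matrix.of fun _ j => π j
  have hinj : Function.Injective fun v : S → ℝ => Matrix.vecMul v M := by
    refine (injective_iff_map_eq_zero (Matrix.vecMulLinear M)).2 fun v hv => ?_
    have hv' : ∀ j, v j - ∑ i, v i * P i j + (∑ i, v i) * π j = 0 := fun j => by
      have := congrFun hv j
      simpa [M, Matrix.vecMul_add, Matrix.vecMul_sub, Matrix.vecMul, dotProduct, sum_mul]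
        using this
    have hv0 : ∑ i, v i = 0 := by
      have h := sum_congr rfl fun j (_ : j ∈ univ) => hv' j
      rw [sum_add_distrib, sum_sub_distrib, sum_comm, ← mul_sum, hsum] at h
      simpa [← mul_sum, hP] using h
    refine eq_zero_of_stationary_of_sum_eq_zero hpos hsum hstat huniq (fun j => ?_) hv0
    have := hv' j
    rw [hv0] at this
    linarith
  obtain ⟨h, hh⟩ := Matrix.mulVec_surjective_iff_isUnit.2
    (Matrix.vecMul_injective_iff_isUnit.1 hinj) f
  refine ⟨∑ j, π j * h j, h, fun i => ?_⟩
  have := congrFun hh i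
  simp only [M, Matrix.add_mulVec, Matrix.sub_mulVec, Matrix.one_mulVec, Pi.add_apply,
    Pi.sub_apply] at this
  simp only [Matrix.mulVec, dotProduct, Matrix.of_apply] at this
  linarith

open Finset in
/-- Adding the drift of a function `h` to the cost does not change the long-run average. -/
theorem sum_stationary_mul_add_drift {S A : Type*} [Fintype S] [Fintype A]
    {p : S → A → S → ℝ} {d : S → A → ℝ} {π : S → ℝ} (hd : ∀ i, ∑ a, d i a = 1)
    (hstat : ∀ j, ∑ i, π i * ∑ a, d i a * p i a j = π j) (f : S → A → ℝ) (h : S → ℝ) :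
    ∑ i, ∑ a, π i * d i a * (f i a + ∑ j, p i a j * h j - h i) =
      ∑ i, ∑ a, π i * d i a * f i a := by
  have h1 : ∑ i, ∑ a, π i * d i a * ∑ j, p i a j * h j = ∑ j, π j * h j := by
    calc ∑ i, ∑ a, π i * d i a * ∑ j, p i a j * h j
        = ∑ i, ∑ j, ∑ a, π i * d i a * (p i a j * h j) := by
          refine sum_congr rfl fun i _ => ?_
          rw [sum_comm]
          simp only [mul_sum]
      _ = ∑ j, (∑ i, π i * ∑ a, d i a * p i a j) * h j := by
          rw [sum_comm]
          simp only [mul_sum, sum_mul, mul_assoc]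
      _ = ∑ j, π j * h j := by simp only [hstat]
  have h2 : ∑ i, ∑ a, π i * d i a * h i = ∑ i, π i * h i := by
    refine sum_congr rfl fun i _ => ?_
    rw [← sum_mul, ← mul_sum, hd, mul_one]
  simp only [mul_sub, mul_add, sum_sub_distrib, sum_add_distrib, h1, h2, add_sub_cancel_right]

theorem detPolicy_mem_Icc {S A : Type*} [DecidableEq A] (d₀ : S → A) (i : S) (a : A) :
    0 ≤ detPolicy d₀ i a ∧ detPolicy d₀ i a ≤ 1 := by
  unfold detPolicy; split_ifs <;> norm_num

theorem sum_detPolicy_mul {S A : Type*} [Fintype A] [DecidableEq A] (d₀ : S → A) (i : S)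
    (x : A → ℝ) : ∑ a, detPolicy d₀ i a * x a = x (d₀ i) := by
  simp [detPolicy]

theorem sum_detPolicy {S A : Type*} [Fintype A] [DecidableEq A] (d₀ : S → A) (i : S) :
    ∑ a, detPolicy d₀ i a = 1 := by
  simp [detPolicy]

open Finset in
/-- For the long-run average of a cost `f`, some deterministic policy is optimal among all
stationary randomized policies. -/
theorem exists_detPolicy_average_cost_le
    {S A : Type*} [Fintype S] [Fintype A] [Nonempty A] [DecidableEq A]
    (p : S → A → S → ℝ) (hp1 : ∀ i a, ∑ j, p i a j = 1)
    (sd : (S → A → ℝ) → S → ℝ)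
    (hsd : ∀ d : S → A → ℝ, (∀ i a, 0 ≤ d i a ∧ d i a ≤ 1) → (∀ i, ∑ a, d i a = 1) →
      (∀ i, 0 < sd d i) ∧ (∑ i, sd d i = 1) ∧
      (∀ j, ∑ i, sd d i * (∑ a, d i a * p i a j) = sd d j) ∧
      (∀ π : S → ℝ, (∀ i, 0 ≤ π i) → (∑ i, π i = 1) →
        (∀ j, ∑ i, π i * (∑ a, d i a * p i a j) = π j) → π = sd d))
    (f : S → A → ℝ) :
    ∃ d₀ : S → A, ∀ d : S → A → ℝ, (∀ i a, 0 ≤ d i a ∧ d i a ≤ 1) → (∀ i, ∑ a, d i a = 1) →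
      ∑ i, ∑ a, sd (detPolicy d₀) i * detPolicy d₀ i a * f i a ≤
        ∑ i, ∑ a, sd d i * d i a * f i a := by
  classical
  obtain ⟨d₀, hmin⟩ := Finite.exists_min fun d₀ : S → A =>
    ∑ i, ∑ a, sd (detPolicy d₀) i * detPolicy d₀ i a * f i a
  refine ⟨d₀, fun d hd hd1 => ?_⟩
  obtain ⟨hpos, hsum, hstat, huniq⟩ := hsd _ (detPolicy_mem_Icc d₀) (sum_detPolicy d₀)
  obtain ⟨g, h, hgh⟩ := exists_poisson_solution
    (P := fun i j => ∑ a, detPolicy d₀ i a * p i a j)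
    (fun i => by simp only [sum_detPolicy_mul, hp1]) hpos hsum hstat huniq
    (fun i => f i (d₀ i))
  simp only [sum_detPolicy_mul] at hgh
  have hdet : ∀ d₁ : S → A, ∑ i, ∑ a, sd (detPolicy d₁) i * detPolicy d₁ i a * f i a =
      ∑ i, sd (detPolicy d₁) i * (f i (d₁ i) + ∑ j, p i (d₁ i) j * h j - h i) := fun d₁ => by
    obtain ⟨-, -, hstat₁, -⟩ := hsd _ (detPolicy_mem_Icc d₁) (sum_detPolicy d₁)
    rw [← sum_stationary_mul_add_drift (sum_detPolicy d₁) hstat₁ f h]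
    simp only [mul_assoc, ← mul_sum, sum_detPolicy_mul]
  have hval : ∑ i, ∑ a, sd (detPolicy d₀) i * detPolicy d₀ i a * f i a = g := by
    rw [hdet]
    simp only [hgh, ← sum_mul, hsum, one_mul]
  have hopt : ∀ i a, g ≤ f i a + ∑ j, p i a j * h j - h i := by
    by_contra! hcon
    obtain ⟨i, a, hia⟩ := hcon
    obtain ⟨hpos₁, hsum₁, -, -⟩ := hsd _ (detPolicy_mem_Icc (Function.update d₀ i a))
      (sum_detPolicy _)
    have hle := hmin (Function.update d₀ i a)
    refine hle.not_gt ?_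
    simp only [hval]
    rw [hdet]
    calc _ < ∑ k, sd (detPolicy (Function.update d₀ i a)) k * g := by
          refine sum_lt_sum (fun k _ => mul_le_mul_of_nonneg_left ?_ (hpos₁ k).le)
            ⟨i, mem_univ i, mul_lt_mul_of_pos_left ?_ (hpos₁ i)⟩
          · obtain rfl | hk := eq_or_ne k i
            · simpa using hia.le
            · simpa [hk] using (hgh k).le
          · simpa using hia
      _ = g := by rw [← sum_mul, hsum₁, one_mul]
  obtain ⟨hpos₂, hsum₂, hstat₂, -⟩ := hsd d hd hd1
  rw [hval, ← sum_stationary_mul_add_drift hd1 hstat₂ f h]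
  calc g = ∑ i, ∑ a, sd d i * d i a * g := by
        simp only [← sum_mul, ← mul_sum, hd1, mul_one, hsum₂, one_mul]
    _ ≤ _ := sum_le_sum fun i _ => sum_le_sum fun a _ =>
        mul_le_mul_of_nonneg_left (hopt i a) (mul_nonneg (hpos₂ i).le (hd i a).1)

theorem le_ctil {S A : Type*} {α : ℝ} (hα : α ∈ Set.Ioo (0 : ℝ) 1) (c : S → A → ℝ) (y : ℝ)
    (i : S) (a : A) : c i a ≤ ctil α c y i a := by
  have h1 : 1 ≤ (1 - α)⁻¹ :=
    (one_le_inv₀ (by linarith [hα.2])).2 (by linarith [hα.1])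
  have h2 := le_mul_of_one_le_left (le_max_right (c i a - y) 0) h1
  have h3 := le_max_left (c i a - y) 0
  unfold ctil
  linarith

open Finset in
theorem bddBelow_range_sum_ctil {S A : Type*} [Fintype S] [Fintype A] {α : ℝ}
    (hα : α ∈ Set.Ioo (0 : ℝ) 1) (c : S → A → ℝ) {π : S → ℝ} {d : S → A → ℝ}
    (hπ : ∀ i, 0 ≤ π i) (hd : ∀ i a, 0 ≤ d i a) :
    BddBelow (Set.range fun y : ℝ => ∑ i, ∑ a, π i * d i a * ctil α c y i a) := by
  refine ⟨∑ i, ∑ a, π i * d i a * c i a, ?_⟩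
  rintro _ ⟨y, rfl⟩
  exact sum_le_sum fun i _ => sum_le_sum fun a _ =>
    mul_le_mul_of_nonneg_left (le_ctil hα c y i a) (mul_nonneg (hπ i) (hd i a))

/-- If every stationary randomized policy has a unique stationary
probability vector, which is everywhere positive, then the minimum of the long-run CVaR
over all stationary randomized policies is achieved by a deterministic stationary
policy. -/
theorem deterministic_policy_optimal_for_cvar
    {S A : Type*} [Fintype S] [Fintype A] [Nonempty S] [Nonempty A] [DecidableEq A]
    (p : S → A → S → ℝ) (hp0 : ∀ i a j, 0 ≤ p i a j) (hp1 : ∀ i a, ∑ j, p i a j = 1)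
    (c : S → A → ℝ) (α : ℝ) (hα : α ∈ Set.Ioo (0 : ℝ) 1)
    (sd : (S → A → ℝ) → S → ℝ)
    (hsd : ∀ d : S → A → ℝ, (∀ i a, 0 ≤ d i a ∧ d i a ≤ 1) → (∀ i, ∑ a, d i a = 1) →
      (∀ i, 0 < sd d i) ∧ (∑ i, sd d i = 1) ∧
      (∀ j, ∑ i, sd d i * (∑ a, d i a * p i a j) = sd d j) ∧
      (∀ π : S → ℝ, (∀ i, 0 ≤ π i) → (∑ i, π i = 1) →
        (∀ j, ∑ i, π i * (∑ a, d i a * p i a j) = π j) → π = sd d)) :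
    ∃ d₀ : S → A,
      ∀ d : S → A → ℝ, (∀ i a, 0 ≤ d i a ∧ d i a ≤ 1) → (∀ i, ∑ a, d i a = 1) →
        CVrand α c (sd (detPolicy d₀)) (detPolicy d₀) ≤ CVrand α c (sd d) d := by
  obtain ⟨d₀, hmin⟩ := Finite.exists_min fun d₀ : S → A =>
    CVrand α c (sd (detPolicy d₀)) (detPolicy d₀)
  refine ⟨d₀, fun d hd hd1 => le_csInf (Set.range_nonempty _) ?_⟩
  rintro _ ⟨y, rfl⟩
  obtain ⟨d₁, h₁⟩ := exists_detPolicy_average_cost_le p hp1 sd hsd (ctil α c y)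
  have hpos := (hsd _ (detPolicy_mem_Icc d₁) (sum_detPolicy d₁)).1
  have hle : CVrand α c (sd (detPolicy d₁)) (detPolicy d₁) ≤
      ∑ i, ∑ a, sd (detPolicy d₁) i * detPolicy d₁ i a * ctil α c y i a :=
    csInf_le (bddBelow_range_sum_ctil hα c (fun i => (hpos i).le)
      fun i a => (detPolicy_mem_Icc d₁ i a).1) ⟨y, rfl⟩
  exact (hmin d₁).trans (hle.trans (h₁ d hd hd1))
end

section
/- Long-run CVaR difference formula: let d and d' be deterministic policies, let y := VaR^d, and let g : S → ℝ be a solution of the Poisson equation for d at y, i.e. g(i) = c̃(y,i,d(i)) - ṼC^d(y) + Σ_{j∈S} p(j|i,d(i))·g(j) for all i. Then CVaR^{d'} - CVaR^{d} = Σ_{i∈S} π^{d'}(i)·[ Σ_{j∈S} (p(j|i,d'(i)) - p(j|i,d(i)))·g(j) + c̃(y,i,d'(i)) - c̃(y,i,d(i)) ] + Δ, where Δ := CVaR^{d'} - ṼC^{d'}(y), and moreover Δ ≤ 0. -/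
/-- The infimum of `{w | α ≤ ∑_{x i ≤ w} π i}` is an `α`-quantile of the finite distribution `π`. -/
theorem sInf_quantile_spec {S : Type*} [Fintype S] {π x : S → ℝ} {α : ℝ}
    (hα0 : 0 < α) (hα1 : α ≤ 1) (h0 : ∀ i, 0 ≤ π i) (h1 : ∑ i, π i = 1) :
    let v := sInf {w : ℝ | α ≤ ∑ i, if x i ≤ w then π i else 0}
    (α ≤ ∑ i, if x i ≤ v then π i else 0) ∧ (∑ i, if x i < v then π i else 0) ≤ α := by
  intro v
  obtain ⟨M, hM⟩ := (Set.finite_range x).bddAbove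
  obtain ⟨m, hm⟩ := (Set.finite_range x).bddBelow
  have hne : {w : ℝ | α ≤ ∑ i, if x i ≤ w then π i else 0}.Nonempty := by
    refine ⟨M, ?_⟩
    have hxM : ∀ i, x i ≤ M := fun i => hM ⟨i, rfl⟩
    simpa [hxM, h1] using hα1
  have hbdd : BddBelow {w : ℝ | α ≤ ∑ i, if x i ≤ w then π i else 0} := by
    refine ⟨m, fun w hw => ?_⟩
    by_contra! hlt
    have hxw : ∀ i, ¬ x i ≤ w := fun i => not_le.2 (hlt.trans_le (hm ⟨i, rfl⟩))
    simp only [Set.mem_ofPred_eq, hxw, if_false, Finset.sum_const_zero] at hw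
    exact hw.not_gt hα0
  constructor
  · have hev : ∀ᶠ z in nhdsWithin v (Set.Ioi v), ∀ i, x i ≤ z → x i ≤ v := by
      refine Filter.eventually_all.2 fun i => ?_
      by_cases hi : x i ≤ v
      · exact Filter.Eventually.of_forall fun _ _ => hi
      · filter_upwards [nhdsWithin_le_nhds (Iio_mem_nhds (not_le.1 hi))] with z hz hxz
        exact absurd hxz (not_le.2 hz)
    obtain ⟨z, hz, hvz⟩ := (hev.and self_mem_nhdsWithin).exists
    obtain ⟨w, hw, hwz⟩ := exists_lt_of_csInf_lt hne hvz
    refine le_trans hw (Finset.sum_le_sum fun i _ => ?_)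
    have := h0 i
    have := hz i
    split_ifs <;> grind
  · have hev : ∀ᶠ z in nhdsWithin v (Set.Iio v), ∀ i, x i < v → x i ≤ z := by
      refine Filter.eventually_all.2 fun i => ?_
      by_cases hi : x i < v
      · filter_upwards [nhdsWithin_le_nhds (Ioi_mem_nhds hi)] with z hz _
        exact le_of_lt hz
      · exact Filter.Eventually.of_forall fun _ h => absurd h hi
    obtain ⟨z, hz, hzv⟩ := (hev.and self_mem_nhdsWithin).exists
    have hnot := notMem_of_lt_csInf hzv hbdd
    refine le_trans (Finset.sum_le_sum fun i _ => ?_) (not_le.1 hnot).le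
    have := h0 i
    have := hz i
    split_ifs <;> grind

/-- An `α`-quantile minimizes the Rockafellar–Uryasev functional. -/
theorem quantile_minimizes {S : Type*} [Fintype S] {π x : S → ℝ} {α v : ℝ}
    (hα1 : α < 1) (h0 : ∀ i, 0 ≤ π i) (h1 : ∑ i, π i = 1)
    (hle : α ≤ ∑ i, if x i ≤ v then π i else 0)
    (hlt : (∑ i, if x i < v then π i else 0) ≤ α) (z : ℝ) :
    v + (1 - α)⁻¹ * ∑ i, π i * max (x i - v) 0 ≤
      z + (1 - α)⁻¹ * ∑ i, π i * max (x i - z) 0 := by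
  have hpos : 0 < 1 - α := sub_pos.2 hα1
  suffices h : (1 - α) * (v - z) + ∑ i, π i * max (x i - v) 0 ≤
      ∑ i, π i * max (x i - z) 0 by
    have h' := mul_le_mul_of_nonneg_left h (inv_pos.2 hpos).le
    rw [mul_add, inv_mul_cancel_left₀ hpos.ne'] at h'
    linarith
  rcases le_total v z with hvz | hzv
  · have key : ∑ i, π i * max (x i - v) 0 ≤ ∑ i, (π i * max (x i - z) 0 +
        (z - v) * (π i - if x i ≤ v then π i else 0)) := by
      refine Finset.sum_le_sum fun i _ => ?_
      split_ifs with h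
      · rw [max_eq_right (by linarith), max_eq_right (by linarith)]
        simp
      · have : max (x i - v) 0 ≤ max (x i - z) 0 + (z - v) := by
          grind
        nlinarith [mul_le_mul_of_nonneg_left this (h0 i)]
    rw [Finset.sum_add_distrib, ← Finset.mul_sum, Finset.sum_sub_distrib, h1] at key
    nlinarith [mul_le_mul_of_nonneg_left hle (sub_nonneg.2 hvz)]
  · have key : ∑ i, (π i * max (x i - v) 0 +
        (v - z) * (π i - if x i < v then π i else 0)) ≤ ∑ i, π i * max (x i - z) 0 := by
      refine Finset.sum_le_sum fun i _ => ?_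
      split_ifs with h
      · rw [max_eq_right (by linarith)]
        simpa using mul_nonneg (h0 i) (le_max_right _ _)
      · rw [max_eq_left (by linarith), max_eq_left (by linarith)]
        linarith
    rw [Finset.sum_add_distrib, ← Finset.mul_sum, Finset.sum_sub_distrib, h1] at key
    nlinarith [mul_le_mul_of_nonneg_left hlt (sub_nonneg.2 hzv)]

/-- The pseudo CVaR in Rockafellar–Uryasev form. -/
theorem pC_eq {S A : Type*} [Fintype S] (α : ℝ) (c : S → A → ℝ) {π : S → ℝ}
    (h1 : ∑ i, π i = 1) (d : S → A) (z : ℝ) :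
    pC α c π d z = z + (1 - α)⁻¹ * ∑ i, π i * max (c i (d i) - z) 0 := by
  simp only [pC, ctil, mul_add, Finset.sum_add_distrib, ← Finset.sum_mul, h1, one_mul,
    Finset.mul_sum]
  congr 1
  exact Finset.sum_congr rfl fun i _ => by ring

/-- The pseudo CVaR attains its minimum at the VaR. -/
theorem isLeast_pC_VaR {S A : Type*} [Fintype S] {α : ℝ} (hα : α ∈ Set.Ioo (0 : ℝ) 1)
    (c : S → A → ℝ) {π : S → ℝ} (h0 : ∀ i, 0 ≤ π i) (h1 : ∑ i, π i = 1) (d : S → A) :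
    IsLeast (Set.range (pC α c π d)) (pC α c π d (VaR α c π d)) := by
  refine ⟨⟨_, rfl⟩, ?_⟩
  rintro _ ⟨z, rfl⟩
  obtain ⟨hle, hlt⟩ := sInf_quantile_spec (x := fun i => c i (d i)) hα.1 hα.2.le h0 h1
  rw [pC_eq α c h1, pC_eq α c h1]
  exact quantile_minimizes hα.2 h0 h1 hle hlt z

/-- Long-run CVaR difference formula, with non-positive distortion term
`Δ = CVaR^{d'} - ṼC^{d'}(VaR^d)`. -/
theorem cvar_difference_formula
    {S A : Type*} [Fintype S] [Fintype A] [Nonempty S] [Nonempty A]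
    (p : S → A → S → ℝ) (hp0 : ∀ i a j, 0 ≤ p i a j) (hp1 : ∀ i a, ∑ j, p i a j = 1)
    (c : S → A → ℝ) (α : ℝ) (hα : α ∈ Set.Ioo (0 : ℝ) 1)
    (sd : (S → A) → S → ℝ)
    (hsd0 : ∀ d i, 0 ≤ sd d i) (hsd1 : ∀ d, ∑ i, sd d i = 1)
    (hsdstat : ∀ (d : S → A) (j : S), ∑ i, sd d i * p i (d i) j = sd d j)
    (d d' : S → A) (y : ℝ) (hy : y = VaR α c (sd d) d)
    (g : S → ℝ)
    (hg : ∀ i, g i = ctil α c y i (d i) - pC α c (sd d) d y + ∑ j, p i (d i) j * g j) :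
    CV α c (sd d') d' - CV α c (sd d) d =
      (∑ i, sd d' i *
        ((∑ j, (p i (d' i) j - p i (d i) j) * g j) +
          ctil α c y i (d' i) - ctil α c y i (d i))) +
      (CV α c (sd d') d' - pC α c (sd d') d' y) ∧
    CV α c (sd d') d' - pC α c (sd d') d' y ≤ 0 := by
  have hmin := isLeast_pC_VaR hα c (hsd0 d) (hsd1 d) d
  have hmin' := isLeast_pC_VaR hα c (hsd0 d') (hsd1 d') d'
  have hCV : CV α c (sd d) d = pC α c (sd d) d y := hy ▸ hmin.csInf_eq
  have hstat : ∑ i, sd d' i * ∑ j, p i (d' i) j * g j = ∑ j, sd d' j * g j := by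
    simp only [Finset.mul_sum, ← mul_assoc]
    rw [Finset.sum_comm]
    simp only [← Finset.sum_mul, hsdstat]
  have hsum : (∑ i, sd d' i * ((∑ j, (p i (d' i) j - p i (d i) j) * g j) +
      ctil α c y i (d' i) - ctil α c y i (d i))) =
      pC α c (sd d') d' y - pC α c (sd d) d y := by
    have hterm : ∀ i, sd d' i * ((∑ j, (p i (d' i) j - p i (d i) j) * g j) +
        ctil α c y i (d' i) - ctil α c y i (d i)) =
        sd d' i * (∑ j, p i (d' i) j * g j) - sd d' i * g i +
          sd d' i * ctil α c y i (d' i) - sd d' i * pC α c (sd d) d y := by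
      intro i
      simp only [sub_mul, Finset.sum_sub_distrib]
      linear_combination (sd d' i) * hg i
    simp only [hterm, Finset.sum_add_distrib, Finset.sum_sub_distrib, hstat, ← Finset.sum_mul,
      hsd1]
    simp [pC]
  refine ⟨?_, sub_nonpos.2 (csInf_le hmin'.bddBelow ⟨y, rfl⟩)⟩
  rw [hsum, hCV]
  ring
end

section
/- Policy improvement for long-run CVaR: let d and d' be deterministic policies, let y := VaR^d, and let g : S → ℝ be a solution of the Poisson equation for d at y. If Σ_{j∈S} p(j|i,d'(i))·g(j) + c̃(y,i,d'(i)) ≤ Σ_{j∈S} p(j|i,d(i))·g(j) + c̃(y,i,d(i)) for every state i ∈ S, then CVaR^{d'} ≤ CVaR^{d}. If in addition this inequality is strict for at least one state i and π^{d'}(i) > 0 for all i ∈ S, then CVaR^{d'} < CVaR^{d}. -/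
open Filter Topology

/-- The mass that `π` puts on the states whose cost under `d` is at most `w`. -/
noncomputable def costCDF {S A : Type*} [Fintype S] (c : S → A → ℝ) (π : S → ℝ)
    (d : S → A) (w : ℝ) : ℝ :=
  ∑ i, if c i (d i) ≤ w then π i else 0

lemma ctil_subgradient {S A : Type*} {α : ℝ} (hα : α < 1) (c : S → A → ℝ) (w z : ℝ) (i : S)
    (a : A) :
    ctil α c w i a + (z - w) * (1 - (1 - α)⁻¹ * (1 - if c i a ≤ w then 1 else 0)) ≤
      ctil α c z i a := by
  have hk : 0 ≤ (1 - α)⁻¹ := inv_nonneg.mpr (by linarith)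
  have key : max (c i a - w) 0 - (z - w) * (1 - if c i a ≤ w then 1 else 0) ≤
      max (c i a - z) 0 := by
    split_ifs with h
    · rw [max_eq_right (by linarith)]
      linarith [le_max_right (c i a - z) 0]
    · rw [max_eq_left (by linarith)]
      linarith [le_max_left (c i a - z) 0]
  have := mul_le_mul_of_nonneg_left key hk
  unfold ctil
  linarith

lemma pC_subgradient {S A : Type*} [Fintype S] {α : ℝ} (hα : α < 1) (c : S → A → ℝ)
    {π : S → ℝ} (hπ0 : ∀ i, 0 ≤ π i) (hπ1 : ∑ i, π i = 1) (d : S → A) (w z : ℝ) :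
    pC α c π d w + (z - w) * (1 - (1 - α)⁻¹ * (1 - costCDF c π d w)) ≤ pC α c π d z := by
  have h : ∑ i, π i * (ctil α c w i (d i) +
      (z - w) * (1 - (1 - α)⁻¹ * (1 - if c i (d i) ≤ w then 1 else 0))) ≤ pC α c π d z :=
    Finset.sum_le_sum fun i _ =>
      mul_le_mul_of_nonneg_left (ctil_subgradient hα c w z i (d i)) (hπ0 i)
  refine le_of_eq_of_le ?_ h
  have hF : costCDF c π d w = ∑ i, π i * (if c i (d i) ≤ w then 1 else 0) := by
    simp [costCDF]
  calc _ = pC α c π d w + (z - w) * (∑ i, π i - (1 - α)⁻¹ * (∑ i, π i -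
        ∑ i, π i * (if c i (d i) ≤ w then 1 else 0))) := by rw [hπ1, hF]
    _ = _ := by
      rw [pC, ← Finset.sum_sub_distrib, Finset.mul_sum, ← Finset.sum_sub_distrib,
        Finset.mul_sum, ← Finset.sum_add_distrib]
      exact Finset.sum_congr rfl fun i _ => by ring

lemma continuous_pC {S A : Type*} [Fintype S] (α : ℝ) (c : S → A → ℝ) (π : S → ℝ)
    (d : S → A) : Continuous (pC α c π d) := by
  unfold pC ctil
  fun_prop

lemma costCDF_mono {S A : Type*} [Fintype S] (c : S → A → ℝ) {π : S → ℝ}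
    (hπ0 : ∀ i, 0 ≤ π i) (d : S → A) : Monotone (costCDF c π d) := by
  intro v w hvw
  refine Finset.sum_le_sum fun i _ => ?_
  split_ifs with h₁ h₂
  · exact le_rfl
  · exact absurd (h₁.trans hvw) h₂
  · exact hπ0 i
  · exact le_rfl

/-- The value at risk minimises the pseudo CVaR. -/
lemma pC_VaR_le {S A : Type*} [Fintype S] {α : ℝ} (hα : α ∈ Set.Ioo (0 : ℝ) 1)
    (c : S → A → ℝ) {π : S → ℝ} (hπ0 : ∀ i, 0 ≤ π i) (hπ1 : ∑ i, π i = 1) (d : S → A)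
    (z : ℝ) : pC α c π d (VaR α c π d) ≤ pC α c π d z := by
  obtain ⟨hα0, hα1⟩ := hα
  set W : Set ℝ := {w | α ≤ costCDF c π d w} with hW
  have hVaR : VaR α c π d = sInf W := rfl
  have hne : W.Nonempty := by
    obtain ⟨M, hM⟩ := (Set.finite_range fun i => c i (d i)).bddAbove
    refine ⟨M, ?_⟩
    have : costCDF c π d M = 1 := by
      rw [← hπ1]
      exact Finset.sum_congr rfl fun i _ => if_pos (hM ⟨i, rfl⟩)
    simp only [hW, Set.mem_ofPred_eq, this]
    exact hα1.le
  have hbdd : BddBelow W := by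
    obtain ⟨m, hm⟩ := (Set.finite_range fun i => c i (d i)).bddBelow
    refine ⟨m, fun w hw => ?_⟩
    by_contra! hlt
    have : costCDF c π d w = 0 :=
      Finset.sum_eq_zero fun i _ => if_neg (not_le.mpr (hlt.trans_le (hm ⟨i, rfl⟩)))
    simp only [hW, Set.mem_ofPred_eq, this] at hw
    linarith
  have hinv : (1 - α)⁻¹ * (1 - α) = 1 := inv_mul_cancel₀ (by linarith)
  have hk : 0 ≤ (1 - α)⁻¹ := inv_nonneg.mpr (by linarith)
  rw [hVaR]
  rcases lt_trichotomy z (sInf W) with hz | hz | hz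
  · refine le_of_tendsto
      ((continuous_pC α c π d).continuousAt.tendsto.mono_left
        (nhdsWithin_le_nhds (s := Set.Iio (sInf W)))) ?_
    filter_upwards [Ioo_mem_nhdsLT hz] with w hw
    have hF : costCDF c π d w < α := not_le.mp (notMem_of_lt_csInf (s := W) hw.2 hbdd)
    have h := pC_subgradient hα1 c hπ0 hπ1 d w z
    have h' := mul_le_mul_of_nonneg_left (show 1 - α ≤ 1 - costCDF c π d w by linarith) hk
    have := mul_nonneg_of_nonpos_of_nonpos (show z - w ≤ 0 by linarith [hw.1])
      (show 1 - (1 - α)⁻¹ * (1 - costCDF c π d w) ≤ 0 by linarith)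
    linarith
  · rw [hz]
  · refine le_of_tendsto
      ((continuous_pC α c π d).continuousAt.tendsto.mono_left
        (nhdsWithin_le_nhds (s := Set.Ioi (sInf W)))) ?_
    filter_upwards [Ioo_mem_nhdsGT hz] with w hw
    obtain ⟨v, hv, hvw⟩ := exists_lt_of_csInf_lt hne hw.1
    have hF : α ≤ costCDF c π d w := le_trans hv (costCDF_mono c hπ0 d hvw.le)
    have h := pC_subgradient hα1 c hπ0 hπ1 d w z
    have h' := mul_le_mul_of_nonneg_left (show 1 - costCDF c π d w ≤ 1 - α by linarith) hk
    have := mul_nonneg (show 0 ≤ z - w by linarith [hw.2])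
      (show 0 ≤ 1 - (1 - α)⁻¹ * (1 - costCDF c π d w) by linarith)
    linarith

lemma CV_le_pC {S A : Type*} [Fintype S] {α : ℝ} (hα : α ∈ Set.Ioo (0 : ℝ) 1)
    (c : S → A → ℝ) {π : S → ℝ} (hπ0 : ∀ i, 0 ≤ π i) (hπ1 : ∑ i, π i = 1) (d : S → A)
    (z : ℝ) : CV α c π d ≤ pC α c π d z :=
  csInf_le ⟨_, Set.forall_mem_range.mpr (pC_VaR_le hα c hπ0 hπ1 d)⟩ ⟨z, rfl⟩

lemma CV_eq_pC_VaR {S A : Type*} [Fintype S] {α : ℝ} (hα : α ∈ Set.Ioo (0 : ℝ) 1)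
    (c : S → A → ℝ) {π : S → ℝ} (hπ0 : ∀ i, 0 ≤ π i) (hπ1 : ∑ i, π i = 1) (d : S → A) :
    CV α c π d = pC α c π d (VaR α c π d) :=
  le_antisymm (CV_le_pC hα c hπ0 hπ1 d _)
    (le_csInf (Set.range_nonempty _) (Set.forall_mem_range.mpr (pC_VaR_le hα c hπ0 hπ1 d)))

/-- Averaging against a stationary distribution is invariant under the transition matrix. -/
lemma sum_stationary_mul {S : Type*} [Fintype S] {P : S → S → ℝ} {π : S → ℝ}
    (hπ : ∀ j, ∑ i, π i * P i j = π j) (g : S → ℝ) :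
    ∑ i, π i * ∑ j, P i j * g j = ∑ j, π j * g j := by
  simp_rw [Finset.mul_sum]
  rw [Finset.sum_comm]
  refine Finset.sum_congr rfl fun j _ => ?_
  rw [← hπ j, Finset.sum_mul]
  exact Finset.sum_congr rfl fun i _ => by ring

/-- Policy improvement for long-run CVaR: an improvement in the
Bellman-type comparison at `y = VaR^d` yields a policy with no larger (resp. strictly
smaller, given a strict improvement somewhere and positivity of `π^{d'}`) long-run
CVaR. -/
theorem cvar_policy_improvement
    {S A : Type*} [Fintype S] [Fintype A] [Nonempty S] [Nonempty A]
    (p : S → A → S → ℝ) (hp0 : ∀ i a j, 0 ≤ p i a j) (hp1 : ∀ i a, ∑ j, p i a j = 1)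
    (c : S → A → ℝ) (α : ℝ) (hα : α ∈ Set.Ioo (0 : ℝ) 1)
    (sd : (S → A) → S → ℝ)
    (hsd0 : ∀ d i, 0 ≤ sd d i) (hsd1 : ∀ d, ∑ i, sd d i = 1)
    (hsdstat : ∀ (d : S → A) (j : S), ∑ i, sd d i * p i (d i) j = sd d j)
    (d d' : S → A) (y : ℝ) (hy : y = VaR α c (sd d) d)
    (g : S → ℝ)
    (hg : ∀ i, g i = ctil α c y i (d i) - pC α c (sd d) d y + ∑ j, p i (d i) j * g j)
    (himp : ∀ i, (∑ j, p i (d' i) j * g j) + ctil α c y i (d' i) ≤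
      (∑ j, p i (d i) j * g j) + ctil α c y i (d i)) :
    CV α c (sd d') d' ≤ CV α c (sd d) d ∧
    ((∃ i, (∑ j, p i (d' i) j * g j) + ctil α c y i (d' i) <
        (∑ j, p i (d i) j * g j) + ctil α c y i (d i)) →
      (∀ i, 0 < sd d' i) →
      CV α c (sd d') d' < CV α c (sd d) d) := by
  have hlhs : ∑ i, sd d' i * ((∑ j, p i (d' i) j * g j) + ctil α c y i (d' i)) =
      ∑ i, sd d' i * g i + pC α c (sd d') d' y := by
    simp_rw [mul_add]
    rw [Finset.sum_add_distrib,
      sum_stationary_mul (P := fun i j => p i (d' i) j) (hsdstat d') g, pC]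
  have hrhs : ∑ i, sd d' i * ((∑ j, p i (d i) j * g j) + ctil α c y i (d i)) =
      ∑ i, sd d' i * g i + pC α c (sd d) d y := by
    have h : ∀ i, (∑ j, p i (d i) j * g j) + ctil α c y i (d i) =
        g i + pC α c (sd d) d y := fun i => by linarith [hg i]
    simp_rw [h, mul_add]
    rw [Finset.sum_add_distrib, ← Finset.sum_mul, hsd1, one_mul]
  have hCV : CV α c (sd d) d = pC α c (sd d) d y := by
    rw [hy]
    exact CV_eq_pC_VaR hα c (hsd0 d) (hsd1 d) d
  have hCV' := CV_le_pC hα c (hsd0 d') (hsd1 d') d' y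
  refine ⟨?_, fun ⟨k, hk⟩ hpos => ?_⟩
  · have := Finset.sum_le_sum fun i (_ : i ∈ Finset.univ) =>
      mul_le_mul_of_nonneg_left (himp i) (hsd0 d' i)
    rw [hlhs, hrhs] at this
    linarith
  · have := Finset.sum_lt_sum
      (fun i (_ : i ∈ Finset.univ) => mul_le_mul_of_nonneg_left (himp i) (hsd0 d' i))
      ⟨k, Finset.mem_univ k, mul_lt_mul_of_pos_left hk (hpos k)⟩
    rw [hlhs, hrhs] at this
    linarith
end

section
/- Stability of VaR and vanishing of the CVaR distortion term under mixing: let d, d' be deterministic policies, and suppose the family of stationary distributions π_δ of the mixed transition matrices P_δ := (1-δ)P^d + δP^{d'} satisfies π_0 = π^d and δ ↦ π_δ is continuous at δ = 0. Assume the nondegeneracy condition at d: Σ_{i : c(i,d(i)) < VaR^d} π^d(i) < α < Σ_{i : c(i,d(i)) ≤ VaR^d} π^d(i). Then there exists ε > 0 such that for all δ ∈ [0, ε]: VaR^δ = VaR^d and CVaR^δ = ṼC_δ(VaR^d); in particular, Δ(δ) := CVaR^δ - ṼC_δ(VaR^d) satisfies Δ(δ)/δ → 0 as δ → 0⁺.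 -/
/-- The mixed pseudo CVaR `ṼC_δ(y)` of the mixture of deterministic policies `d`, `d'`
with mixing probability `δ` and stationary distribution family `πδ`. -/
noncomputable def pCmix {S A : Type*} [Fintype S] (α : ℝ) (c : S → A → ℝ)
    (πδ : ℝ → S → ℝ) (d d' : S → A) (δ y : ℝ) : ℝ :=
  ∑ i, πδ δ i * ((1 - δ) * ctil α c y i (d i) + δ * ctil α c y i (d' i))

/-- The long-run CVaR `CVaR^δ = inf_{y ∈ ℝ} ṼC_δ(y)` of the mixed policy. -/
noncomputable def CVmix {S A : Type*} [Fintype S] (α : ℝ) (c : S → A → ℝ)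
    (πδ : ℝ → S → ℝ) (d d' : S → A) (δ : ℝ) : ℝ :=
  sInf (Set.range (pCmix α c πδ d d' δ))

/-- The long-run VaR `VaR^δ` of the mixed policy. -/
noncomputable def VaRmix {S A : Type*} [Fintype S] (α : ℝ) (c : S → A → ℝ)
    (πδ : ℝ → S → ℝ) (d d' : S → A) (δ : ℝ) : ℝ :=
  sInf {w : ℝ | α ≤ ∑ i, πδ δ i *
    ((1 - δ) * (if c i (d i) ≤ w then (1 : ℝ) else 0) +
      δ * (if c i (d' i) ≤ w then (1 : ℝ) else 0))}

/-- The mean of `f` under the state distribution `q` and the mixture of `d` and `d'` with mixing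
probability `δ`. -/
def mixMean {S A : Type*} [Fintype S] (q : S → ℝ) (d d' : S → A) (δ : ℝ) (f : S → A → ℝ) : ℝ :=
  ∑ i, q i * ((1 - δ) * f i (d i) + δ * f i (d' i))

lemma mixMean_mono {S A : Type*} [Fintype S] {q : S → ℝ} (hq : ∀ i, 0 ≤ q i) (d d' : S → A)
    {δ : ℝ} (hδ : δ ∈ Set.Icc (0 : ℝ) 1) {f g : S → A → ℝ} (hfg : ∀ i a, f i a ≤ g i a) :
    mixMean q d d' δ f ≤ mixMean q d d' δ g := by
  refine Finset.sum_le_sum fun i _ => mul_le_mul_of_nonneg_left ?_ (hq i)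
  exact add_le_add (mul_le_mul_of_nonneg_left (hfg _ _) (by linarith [hδ.2]))
    (mul_le_mul_of_nonneg_left (hfg _ _) hδ.1)

lemma mixMean_add_mul {S A : Type*} [Fintype S] {q : S → ℝ} (hq : ∑ i, q i = 1) (d d' : S → A)
    (δ : ℝ) (f g : S → A → ℝ) (r s : ℝ) :
    mixMean q d d' δ (fun i a => f i a + (r + s * g i a)) =
      mixMean q d d' δ f + (r + s * mixMean q d d' δ g) := by
  have hr : r = ∑ i, q i * r := by rw [← Finset.sum_mul, hq, one_mul]
  unfold mixMean
  conv_rhs => rw [hr]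
  rw [Finset.mul_sum, ← Finset.sum_add_distrib, ← Finset.sum_add_distrib]
  exact Finset.sum_congr rfl fun i _ => by ring

lemma tendsto_mixMean {S A : Type*} [Fintype S] {q : ℝ → S → ℝ} {s : Set ℝ}
    (hq : ContinuousWithinAt q s 0) (d d' : S → A) (f : S → A → ℝ) :
    Filter.Tendsto (fun δ => mixMean (q δ) d d' δ f) (nhdsWithin 0 s)
      (nhds (∑ i, q 0 i * f i (d i))) := by
  have hi : ∀ i, ContinuousWithinAt (fun δ => q δ i) s 0 := continuousWithinAt_pi.mp hq
  have hc : ContinuousWithinAt (fun δ => mixMean (q δ) d d' δ f) s 0 := by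
    unfold mixMean
    refine tendsto_finsetSum _ fun i _ => ?_
    exact (hi i).mul (by fun_prop)
  simpa [ContinuousWithinAt, mixMean] using hc

/-- The subgradient inequality at `v` for the right derivative of `y ↦ ctil α c y i a`. -/
lemma ctil_subgradient_le {S A : Type*} {α : ℝ} (hα : α < 1) (c : S → A → ℝ) (v y : ℝ)
    (i : S) (a : A) :
    ctil α c v i a + ((y - v) * (1 - (1 - α)⁻¹) +
      (y - v) * (1 - α)⁻¹ * (if c i a ≤ v then (1 : ℝ) else 0)) ≤ ctil α c y i a := by
  have hk : 0 < (1 - α)⁻¹ := inv_pos.mpr (by linarith)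
  have key : max (c i a - v) 0 - (y - v) * (1 - (if c i a ≤ v then (1 : ℝ) else 0)) ≤
      max (c i a - y) 0 := by
    split_ifs with hc
    · rw [max_eq_right (by linarith : c i a - v ≤ 0)]
      simp
    · rw [max_eq_left (by linarith : 0 ≤ c i a - v)]
      exact le_max_of_le_left (by linarith)
  have := mul_le_mul_of_nonneg_left key hk.le
  unfold ctil
  linarith

/-- The subgradient inequality at `v` for the left derivative of `y ↦ ctil α c y i a`. -/
lemma ctil_subgradient_lt {S A : Type*} {α : ℝ} (hα : α < 1) (c : S → A → ℝ) (v y : ℝ)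
    (i : S) (a : A) :
    ctil α c v i a + ((y - v) * (1 - (1 - α)⁻¹) +
      (y - v) * (1 - α)⁻¹ * (if c i a < v then (1 : ℝ) else 0)) ≤ ctil α c y i a := by
  have hk : 0 < (1 - α)⁻¹ := inv_pos.mpr (by linarith)
  have key : max (c i a - v) 0 - (y - v) * (1 - (if c i a < v then (1 : ℝ) else 0)) ≤
      max (c i a - y) 0 := by
    split_ifs with hc
    · rw [max_eq_right (by linarith : c i a - v ≤ 0)]
      simp
    · rw [max_eq_left (by linarith : 0 ≤ c i a - v)]
      exact le_max_of_le_left (by linarith)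
  have := mul_le_mul_of_nonneg_left key hk.le
  unfold ctil
  linarith

/-- If the mixed cost lies strictly below `v` with probability less than `α`, and at most at `v` with
probability at least `α`, then `v` is the mixed VaR. -/
lemma VaRmix_eq_of_quantile {S A : Type*} [Fintype S] {α : ℝ} {c : S → A → ℝ}
    {q : ℝ → S → ℝ} {d d' : S → A} {δ v : ℝ} (hδ : δ ∈ Set.Icc (0 : ℝ) 1)
    (hq : ∀ i, 0 ≤ q δ i)
    (hlt : mixMean (q δ) d d' δ (fun i a => if c i a < v then (1 : ℝ) else 0) < α)
    (hle : α ≤ mixMean (q δ) d d' δ (fun i a => if c i a ≤ v then (1 : ℝ) else 0)) :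
    VaRmix α c q d d' δ = v := by
  refine IsLeast.csInf_eq ⟨hle, fun w hw => ?_⟩
  by_contra! hwv
  refine absurd (lt_of_le_of_lt ?_ hlt) (not_lt.mpr hw)
  refine mixMean_mono (f := fun i a => if c i a ≤ w then (1 : ℝ) else 0) hq d d' hδ
    fun i a => ?_
  by_cases h : c i a ≤ w
  · simp [h, h.trans_lt hwv]
  · simp only [h, if_false]
    split_ifs <;> norm_num

/-- An `α`-quantile of the mixed cost distribution minimizes the mixed pseudo CVaR. -/
lemma CVmix_eq_of_quantile {S A : Type*} [Fintype S] {α : ℝ} (hα : α < 1) {c : S → A → ℝ}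
    {q : ℝ → S → ℝ} {d d' : S → A} {δ v : ℝ} (hδ : δ ∈ Set.Icc (0 : ℝ) 1)
    (hq : ∀ i, 0 ≤ q δ i) (hq1 : ∑ i, q δ i = 1)
    (hlt : mixMean (q δ) d d' δ (fun i a => if c i a < v then (1 : ℝ) else 0) ≤ α)
    (hle : α ≤ mixMean (q δ) d d' δ (fun i a => if c i a ≤ v then (1 : ℝ) else 0)) :
    CVmix α c q d d' δ = pCmix α c q d d' δ v := by
  refine IsLeast.csInf_eq ⟨⟨v, rfl⟩, ?_⟩
  rintro _ ⟨y, rfl⟩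
  have hk : 0 < (1 - α)⁻¹ := inv_pos.mpr (by linarith)
  have hk1 : (1 - α)⁻¹ * (1 - α) = 1 := inv_mul_cancel₀ (by linarith)
  change mixMean (q δ) d d' δ (ctil α c v) ≤ mixMean (q δ) d d' δ (ctil α c y)
  rcases le_total v y with h | h
  · have hm := mixMean_mono hq d d' hδ (ctil_subgradient_le hα c v y)
    rw [mixMean_add_mul hq1] at hm
    have := mul_nonneg (mul_nonneg (sub_nonneg.mpr h) hk.le) (sub_nonneg.mpr hle)
    linear_combination hm + this + (y - v) * hk1
  · have hm := mixMean_mono hq d d' hδ (ctil_subgradient_lt hα c v y)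
    rw [mixMean_add_mul hq1] at hm
    have := mul_nonneg (mul_nonneg (sub_nonneg.mpr h) hk.le) (sub_nonneg.mpr hlt)
    linear_combination hm + this + (y - v) * hk1

/-- Stability of VaR under mixing and vanishing of the CVaR distortion
term: under the nondegeneracy condition at `d`, for all small enough `δ ≥ 0` the mixed
VaR equals `VaR^d` and the mixed CVaR equals the mixed pseudo CVaR at `VaR^d`; in
particular `Δ(δ)/δ → 0` as `δ → 0⁺`. -/
theorem var_stability_under_mixing
    {S A : Type*} [Fintype S] [Fintype A] [Nonempty S] [Nonempty A]
    (p : S → A → S → ℝ) (hp0 : ∀ i a j, 0 ≤ p i a j) (hp1 : ∀ i a, ∑ j, p i a j = 1)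
    (c : S → A → ℝ) (α : ℝ) (hα : α ∈ Set.Ioo (0 : ℝ) 1)
    (d d' : S → A) (πd : S → ℝ)
    (hπd0 : ∀ i, 0 ≤ πd i) (hπd1 : ∑ i, πd i = 1)
    (hπdstat : ∀ j, ∑ i, πd i * p i (d i) j = πd j)
    (πδ : ℝ → S → ℝ)
    (hπδ0 : ∀ δ ∈ Set.Icc (0 : ℝ) 1, ∀ i, 0 ≤ πδ δ i)
    (hπδ1 : ∀ δ ∈ Set.Icc (0 : ℝ) 1, ∑ i, πδ δ i = 1)
    (hπδstat : ∀ δ ∈ Set.Icc (0 : ℝ) 1, ∀ j,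
      ∑ i, πδ δ i * ((1 - δ) * p i (d i) j + δ * p i (d' i) j) = πδ δ j)
    (hπδinit : πδ 0 = πd)
    (hπδcont : ContinuousWithinAt πδ (Set.Icc (0 : ℝ) 1) 0)
    (hnondeg :
      (∑ i, if c i (d i) < VaR α c πd d then πd i else 0) < α ∧
      α < ∑ i, if c i (d i) ≤ VaR α c πd d then πd i else 0) :
    (∃ ε > (0 : ℝ), ∀ δ ∈ Set.Icc (0 : ℝ) ε,
      VaRmix α c πδ d d' δ = VaR α c πd d ∧
      CVmix α c πδ d d' δ = pCmix α c πδ d d' δ (VaR α c πd d)) ∧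
    Filter.Tendsto
      (fun δ => (CVmix α c πδ d d' δ - pCmix α c πδ d d' δ (VaR α c πd d)) / δ)
      (nhdsWithin 0 (Set.Ioi 0)) (nhds 0) := by
  set v := VaR α c πd d
  have hL := (tendsto_mixMean hπδcont d d' fun i a => if c i a < v then (1 : ℝ) else 0)
    |>.eventually_lt_const (u := α) (by simpa [hπδinit] using hnondeg.1)
  have hU := (tendsto_mixMean hπδcont d d' fun i a => if c i a ≤ v then (1 : ℝ) else 0)
    |>.eventually_const_lt (u := α) (by simpa [hπδinit] using hnondeg.2)
  have hstab : ∀ᶠ δ in nhdsWithin 0 (Set.Icc (0 : ℝ) 1), VaRmix α c πδ d d' δ = v ∧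
      CVmix α c πδ d d' δ = pCmix α c πδ d d' δ v := by
    filter_upwards [hL, hU, self_mem_nhdsWithin] with δ hl hu hδ
    exact ⟨VaRmix_eq_of_quantile hδ (hπδ0 δ hδ) hl hu.le,
      CVmix_eq_of_quantile hα.2 hδ (hπδ0 δ hδ) (hπδ1 δ hδ) hl.le hu.le⟩
  rw [nhdsWithin_Icc_eq_nhdsGE zero_lt_one] at hstab
  constructor
  · obtain ⟨ε, hε, h⟩ := mem_nhdsGE_iff_exists_Icc_subset.mp hstab
    exact ⟨ε, hε, fun δ hδ => h hδ⟩
  · refine tendsto_const_nhds.congr' ?_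
    filter_upwards [nhdsWithin_mono 0 Set.Ioi_subset_Ici_self hstab] with δ h
    rw [h.2, sub_self, zero_div]
end

section
/- Long-run CVaR derivative formula: let d, d' be deterministic policies, y₀ := VaR^d, and let g be a solution of the Poisson equation for d at y₀. Suppose the family π_δ of stationary distributions of P_δ := (1-δ)P^d + δP^{d'} satisfies π_0 = π^d, δ ↦ π_δ is right-differentiable at δ = 0, and the nondegeneracy condition at d holds: Σ_{i : c(i,d(i)) < y₀} π^d(i) < α < Σ_{i : c(i,d(i)) ≤ y₀} π^d(i). Then the function δ ↦ CVaR^δ has a right derivative at δ = 0, equal to Σ_{i∈S} π^d(i)·[ Σ_{j∈S} (p(j|i,d'(i)) - p(j|i,d(i)))·g(j) + c̃(y₀,i,d'(i)) - c̃(y₀,i,d(i)) ]. -/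
/-- A weighted Rockafellar-Uryasev objective is minimized at any `α`-quantile. -/
theorem weighted_cvar_objective_le {ι : Type*} [Fintype ι] {α y₀ : ℝ} (hα : α < 1)
    (w x : ι → ℝ) (hw0 : ∀ i, 0 ≤ w i) (hw1 : ∑ i, w i = 1)
    (hlt : ∑ i, w i * (if x i < y₀ then 1 else 0) ≤ α)
    (hle : α ≤ ∑ i, w i * (if x i ≤ y₀ then 1 else 0)) (y : ℝ) :
    ∑ i, w i * (y₀ + (1 - α)⁻¹ * max (x i - y₀) 0) ≤
      ∑ i, w i * (y + (1 - α)⁻¹ * max (x i - y) 0) := by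
  have hα' : 0 < 1 - α := sub_pos.2 hα
  have hkα : (1 - α)⁻¹ * (1 - α) = 1 := inv_mul_cancel₀ hα'.ne'
  have hk : 0 < (1 - α)⁻¹ := inv_pos.2 hα'
  generalize (1 - α)⁻¹ = k at hkα hk ⊢
  have expand (e : ι → ℝ) :
      ∑ i, w i * (y₀ + k * max (x i - y₀) 0 + (y - y₀) * (1 - k * (1 - e i))) =
        ∑ i, w i * (y₀ + k * max (x i - y₀) 0) +
          (y - y₀) * (1 - k * (1 - ∑ i, w i * e i)) := by
    have hsum : ∑ i, w i * ((y - y₀) * (1 - k * (1 - e i))) =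
        (y - y₀) * ((1 - k) * ∑ i, w i + k * ∑ i, w i * e i) := by
      simp only [Finset.mul_sum, ← Finset.sum_add_distrib]
      exact Finset.sum_congr rfl fun i _ => by ring
    simp only [mul_add _ (y₀ + _), Finset.sum_add_distrib]
    rw [hsum, hw1]
    ring
  rcases le_total y₀ y with hy | hy
  · have key : ∀ i, y₀ + k * max (x i - y₀) 0 +
        (y - y₀) * (1 - k * (1 - if x i ≤ y₀ then 1 else 0)) ≤ y + k * max (x i - y) 0 := by
      intro i
      split_ifs with h
      · rw [max_eq_right (by linarith : x i - y₀ ≤ 0)]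
        nlinarith [mul_nonneg hk.le (le_max_right (x i - y) 0)]
      · rw [max_eq_left (by linarith : 0 ≤ x i - y₀)]
        nlinarith [mul_le_mul_of_nonneg_left (le_max_left (x i - y) 0) hk.le]
    have h := Finset.sum_le_sum fun i (_ : i ∈ Finset.univ) =>
      mul_le_mul_of_nonneg_left (key i) (hw0 i)
    rw [expand] at h
    nlinarith [mul_nonneg (sub_nonneg.2 hy) (mul_nonneg hk.le (sub_nonneg.2 hle))]
  · have key : ∀ i, y₀ + k * max (x i - y₀) 0 +
        (y - y₀) * (1 - k * (1 - if x i < y₀ then 1 else 0)) ≤ y + k * max (x i - y) 0 := by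
      intro i
      split_ifs with h
      · rw [max_eq_right (by linarith : x i - y₀ ≤ 0)]
        nlinarith [mul_nonneg hk.le (le_max_right (x i - y) 0)]
      · rw [max_eq_left (by linarith : 0 ≤ x i - y₀)]
        nlinarith [mul_le_mul_of_nonneg_left (le_max_left (x i - y) 0) hk.le]
    have h := Finset.sum_le_sum fun i (_ : i ∈ Finset.univ) =>
      mul_le_mul_of_nonneg_left (key i) (hw0 i)
    rw [expand] at h
    nlinarith [mul_nonneg (sub_nonneg.2 hy) (mul_nonneg hk.le (sub_nonneg.2 hlt))]

/-- Right derivative at `0` of the expectation of a mixed quantity under `πδ δ`. -/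
theorem hasDerivWithinAt_sum_mixture {S : Type*} [Fintype S] {πδ : ℝ → S → ℝ} {π' : S → ℝ}
    {s : Set ℝ} (hπ : ∀ i, HasDerivWithinAt (fun δ => πδ δ i) (π' i) s 0) (a b : S → ℝ) :
    HasDerivWithinAt (fun δ => ∑ i, πδ δ i * ((1 - δ) * a i + δ * b i))
      (∑ i, (π' i * a i + πδ 0 i * (b i - a i))) s 0 := by
  refine HasDerivWithinAt.fun_sum fun i _ => ?_
  have hid := hasDerivWithinAt_id (0 : ℝ) s
  have hmix : HasDerivWithinAt (fun δ : ℝ => (1 - δ) * a i + δ * b i) (b i - a i) s 0 :=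
    (((hid.const_sub 1).mul_const (a i)).add (hid.mul_const (b i))).congr_deriv (by ring)
  exact ((hπ i).fun_mul hmix).congr_deriv (by ring)

/-- The mixed CVaR is attained at any `y₀` that is an `α`-quantile of the mixed cost. -/
theorem CVmix_eq_pCmix {S A : Type*} [Fintype S] {α y₀ δ : ℝ} (hα : α < 1) (c : S → A → ℝ)
    (πδ : ℝ → S → ℝ) (d d' : S → A) (hδ : δ ∈ Set.Icc (0 : ℝ) 1)
    (hπ0 : ∀ i, 0 ≤ πδ δ i) (hπ1 : ∑ i, πδ δ i = 1)
    (hlt : ∑ i, πδ δ i * ((1 - δ) * (if c i (d i) < y₀ then 1 else 0) +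
      δ * (if c i (d' i) < y₀ then 1 else 0)) ≤ α)
    (hle : α ≤ ∑ i, πδ δ i * ((1 - δ) * (if c i (d i) ≤ y₀ then 1 else 0) +
      δ * (if c i (d' i) ≤ y₀ then 1 else 0))) :
    CVmix α c πδ d d' δ = pCmix α c πδ d d' δ y₀ := by
  let w : S ⊕ S → ℝ := Sum.elim (fun i => πδ δ i * (1 - δ)) (fun i => πδ δ i * δ)
  let x : S ⊕ S → ℝ := Sum.elim (fun i => c i (d i)) (fun i => c i (d' i))
  have hw (f : S ⊕ S → ℝ) : ∑ k, w k * f k =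
      ∑ i, πδ δ i * ((1 - δ) * f (.inl i) + δ * f (.inr i)) := by
    rw [Fintype.sum_sum_type, ← Finset.sum_add_distrib]
    exact Finset.sum_congr rfl fun i _ => by simp only [w, Sum.elim_inl, Sum.elim_inr]; ring
  refine IsLeast.csInf_eq ⟨⟨y₀, rfl⟩, ?_⟩
  rintro _ ⟨y, rfl⟩
  have h := weighted_cvar_objective_le hα w x (y₀ := y₀)
    (by
      rintro (i | i)
      · exact mul_nonneg (hπ0 i) (sub_nonneg.2 hδ.2)
      · exact mul_nonneg (hπ0 i) hδ.1)
    (by simpa [hπ1] using hw fun _ => 1)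
    (by rw [hw]; exact hlt) (by rw [hw]; exact hle) y
  rw [hw, hw] at h
  exact h

/-- Long-run CVaR derivative formula: under right-differentiability of the
stationary distributions of the mixed chain at `δ = 0` and the nondegeneracy condition
at `d`, the mixed long-run CVaR has a right derivative at `δ = 0` given by the
sensitivity-based-optimization formula. -/
theorem cvar_derivative_formula
    {S A : Type*} [Fintype S] [Fintype A] [Nonempty S] [Nonempty A]
    (p : S → A → S → ℝ) (hp0 : ∀ i a j, 0 ≤ p i a j) (hp1 : ∀ i a, ∑ j, p i a j = 1)
    (c : S → A → ℝ) (α : ℝ) (hα : α ∈ Set.Ioo (0 : ℝ) 1)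
    (d d' : S → A) (πd : S → ℝ)
    (hπd0 : ∀ i, 0 ≤ πd i) (hπd1 : ∑ i, πd i = 1)
    (hπdstat : ∀ j, ∑ i, πd i * p i (d i) j = πd j)
    (y₀ : ℝ) (hy₀ : y₀ = VaR α c πd d)
    (g : S → ℝ)
    (hg : ∀ i, g i = ctil α c y₀ i (d i) - pC α c πd d y₀ + ∑ j, p i (d i) j * g j)
    (πδ : ℝ → S → ℝ)
    (hπδ0 : ∀ δ ∈ Set.Icc (0 : ℝ) 1, ∀ i, 0 ≤ πδ δ i)
    (hπδ1 : ∀ δ ∈ Set.Icc (0 : ℝ) 1, ∑ i, πδ δ i = 1)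
    (hπδstat : ∀ δ ∈ Set.Icc (0 : ℝ) 1, ∀ j,
      ∑ i, πδ δ i * ((1 - δ) * p i (d i) j + δ * p i (d' i) j) = πδ δ j)
    (hπδinit : πδ 0 = πd)
    (πd' : S → ℝ)
    (hπδdiff : ∀ i, HasDerivWithinAt (fun δ => πδ δ i) (πd' i) (Set.Ici (0 : ℝ)) 0)
    (hnondeg :
      (∑ i, if c i (d i) < y₀ then πd i else 0) < α ∧
      α < ∑ i, if c i (d i) ≤ y₀ then πd i else 0) :
    HasDerivWithinAt (fun δ => CVmix α c πδ d d' δ)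
      (∑ i, πd i *
        ((∑ j, (p i (d' i) j - p i (d i) j) * g j) +
          ctil α c y₀ i (d' i) - ctil α c y₀ i (d i)))
      (Set.Ici (0 : ℝ)) 0 := by
  have hmix := hasDerivWithinAt_sum_mixture hπδdiff
  have hcont (a b : S → ℝ) : Filter.Tendsto
      (fun δ => ∑ i, πδ δ i * ((1 - δ) * a i + δ * b i)) (nhdsWithin 0 (Set.Ici 0))
      (nhds (∑ i, πd i * a i)) := by
    simpa [ContinuousWithinAt, hπδinit] using (hmix a b).continuousWithinAt
  have hIcc : ∀ᶠ δ in nhdsWithin (0 : ℝ) (Set.Ici 0), δ ∈ Set.Icc (0 : ℝ) 1 :=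
    Icc_mem_nhdsGE one_pos
  have hCV : (fun δ => CVmix α c πδ d d' δ) =ᶠ[nhdsWithin 0 (Set.Ici 0)]
      fun δ => pCmix α c πδ d d' δ y₀ := by
    filter_upwards [hIcc,
      (hcont (fun i => if c i (d i) < y₀ then 1 else 0)
        (fun i => if c i (d' i) < y₀ then 1 else 0)).eventually_lt_const
          (by simpa using hnondeg.1),
      (hcont (fun i => if c i (d i) ≤ y₀ then 1 else 0)
        (fun i => if c i (d' i) ≤ y₀ then 1 else 0)).eventually_const_lt
          (by simpa using hnondeg.2)] with δ hδ hlt hle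
    exact CVmix_eq_pCmix hα.2 c πδ d d' hδ (hπδ0 δ hδ) (hπδ1 δ hδ) hlt.le hle.le
  have huniq : UniqueDiffWithinAt ℝ (Set.Ici (0 : ℝ)) 0 := uniqueDiffWithinAt_Ici 0
  have hmass : ∑ i, πd' i = 0 := by
    refine huniq.eq_deriv _ (HasDerivWithinAt.fun_sum fun i _ => hπδdiff i) ?_
    refine (hasDerivWithinAt_const (0 : ℝ) _ (1 : ℝ)).congr_of_eventuallyEq ?_ ?_
    · filter_upwards [hIcc] with δ hδ using hπδ1 δ hδ
    · exact hπδ1 0 ⟨le_rfl, zero_le_one⟩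
  have hstat (j : S) :
      ∑ i, (πd' i * p i (d i) j + πd i * (p i (d' i) j - p i (d i) j)) = πd' j := by
    have h := hmix (fun i => p i (d i) j) (fun i => p i (d' i) j)
    rw [hπδinit] at h
    refine huniq.eq_deriv _ h ((hπδdiff j).congr_of_eventuallyEq ?_ ?_)
    · filter_upwards [hIcc] with δ hδ using hπδstat δ hδ j
    · exact hπδstat 0 ⟨le_rfl, zero_le_one⟩ j
  have hpoisson : ∑ i, πd' i * ctil α c y₀ i (d i) =
      ∑ i, πd i * ∑ j, (p i (d' i) j - p i (d i) j) * g j := by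
    calc ∑ i, πd' i * ctil α c y₀ i (d i)
        = ∑ i, (πd' i * g i + πd' i * pC α c πd d y₀ - πd' i * ∑ j, p i (d i) j * g j) :=
          Finset.sum_congr rfl fun i _ => by linear_combination (-πd' i) * hg i
      _ = ∑ j, πd' j * g j - ∑ j, ∑ i, πd' i * (p i (d i) j * g j) := by
          rw [Finset.sum_sub_distrib, Finset.sum_add_distrib, ← Finset.sum_mul, hmass,
            Finset.sum_comm (s := Finset.univ (α := S)) (t := Finset.univ (α := S))]
          simp only [Finset.mul_sum]
          ring
      _ = ∑ j, ∑ i, πd i * ((p i (d' i) j - p i (d i) j) * g j) := by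
          rw [← Finset.sum_sub_distrib]
          refine Finset.sum_congr rfl fun j _ => ?_
          rw [← hstat j, Finset.sum_mul, ← Finset.sum_sub_distrib]
          exact Finset.sum_congr rfl fun i _ => by ring
      _ = ∑ i, πd i * ∑ j, (p i (d' i) j - p i (d i) j) * g j := by
          rw [Finset.sum_comm]
          simp only [Finset.mul_sum]
  have h := hmix (fun i => ctil α c y₀ i (d i)) (fun i => ctil α c y₀ i (d' i))
  refine (h.congr_of_eventuallyEq hCV (hCV.self_of_nhdsWithin Set.self_mem_Ici)).congr_deriv ?_
  rw [hπδinit, Finset.sum_add_distrib, hpoisson, ← Finset.sum_add_distrib]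
  exact Finset.sum_congr rfl fun i _ => by ring
end

section
/- Bellman local optimality implies local optimality in the mixed policy space: let d* be a deterministic policy, y₀ := VaR^{d*}, and g a solution of the Poisson equation for d* at y₀, and suppose d* satisfies the Bellman local optimality condition: for all i ∈ S and a ∈ A, c̃(y₀,i,d*(i)) + Σ_{j∈S} p(j|i,d*(i))·g(j) ≤ c̃(y₀,i,a) + Σ_{j∈S} p(j|i,a)·g(j). Assume the nondegeneracy condition at d*: Σ_{i : c(i,d*(i)) < y₀} π^{d*}(i) < α < Σ_{i : c(i,d*(i)) ≤ y₀} π^{d*}(i), and that for every deterministic policy d' the given family π_δ^{d'} of stationary distributions of P_δ := (1-δ)P^{d*} + δP^{d'} satisfies π_0^{d'} = π^{d*} and is continuous at δ = 0. Then there exists ε > 0 such that for every deterministic policy d' and every δ ∈ [0, ε], CVaR^{δ,d'} ≥ CVaR^{d*}; that is, d* is a local optimum of the long-run CVaR in the mixed policy space. -/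
/-- A quantile at level `α` minimizes the Rockafellar–Uryasev functional of a finite
distribution. -/
lemma quantile_minimizes_pseudoCVaR {ι : Type*} [Fintype ι] (w x : ι → ℝ)
    (hw0 : ∀ k, 0 ≤ w k) (hw1 : ∑ k, w k = 1) {α : ℝ} (hα : α < 1) {y₀ : ℝ}
    (hlt : (∑ k, w k * if x k < y₀ then (1 : ℝ) else 0) ≤ α)
    (hle : α ≤ ∑ k, w k * if x k ≤ y₀ then (1 : ℝ) else 0) (y : ℝ) :
    ∑ k, w k * (y₀ + (1 - α)⁻¹ * max (x k - y₀) 0) ≤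
      ∑ k, w k * (y + (1 - α)⁻¹ * max (x k - y) 0) := by
  have hα' : 0 < 1 - α := by linarith
  have expand (z : ℝ) : ∑ k, w k * (z + (1 - α)⁻¹ * max (x k - z) 0) =
      z + (1 - α)⁻¹ * ∑ k, w k * max (x k - z) 0 := by
    simp only [mul_add, Finset.sum_add_distrib, ← Finset.sum_mul, hw1, one_mul,
      Finset.mul_sum, mul_left_comm]
  have subgradient (s : ι → ℝ)
      (hs : ∀ k, max (x k - y₀) 0 - (y - y₀) * (1 - s k) ≤ max (x k - y) 0) :
      ∑ k, w k * max (x k - y₀) 0 - (y - y₀) * (1 - ∑ k, w k * s k) ≤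
        ∑ k, w k * max (x k - y) 0 := by
    calc _ = ∑ k, w k * (max (x k - y₀) 0 - (y - y₀) * (1 - s k)) := by
          have hs1 : ∑ k, w k * (1 - s k) = 1 - ∑ k, w k * s k := by
            simp only [mul_sub, mul_one, Finset.sum_sub_distrib, hw1]
          rw [← hs1, Finset.mul_sum, ← Finset.sum_sub_distrib]
          exact Finset.sum_congr rfl fun k _ => by ring
      _ ≤ _ := Finset.sum_le_sum fun k _ => mul_le_mul_of_nonneg_left (hs k) (hw0 k)
  have key : ∑ k, w k * max (x k - y₀) 0 - (y - y₀) * (1 - α) ≤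
      ∑ k, w k * max (x k - y) 0 := by
    rcases le_total y₀ y with h | h
    · have := subgradient (fun k => if x k ≤ y₀ then 1 else 0) fun k => by
        split_ifs with hk
        · rw [max_eq_right (by linarith : x k - y₀ ≤ 0)]
          simp
        · rw [max_eq_left (by linarith : 0 ≤ x k - y₀)]
          exact le_max_of_le_left (by linarith)
      nlinarith
    · have := subgradient (fun k => if x k < y₀ then 1 else 0) fun k => by
        split_ifs with hk
        · rw [max_eq_right (by linarith : x k - y₀ ≤ 0)]
          simp
        · rw [max_eq_left (by linarith : 0 ≤ x k - y₀)]
          exact le_max_of_le_left (by linarith)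
      nlinarith
  rw [expand, expand]
  have := mul_le_mul_of_nonneg_left key (inv_pos.2 hα').le
  have hinv : (1 - α)⁻¹ * (1 - α) = 1 := inv_mul_cancel₀ hα'.ne'
  linear_combination this + (y - y₀) * hinv

/-- If `y₀` is an `α`-quantile of the mixed policy, it minimizes the mixed pseudo CVaR. -/
lemma pCmix_min_of_quantile {S A : Type*} [Fintype S] {α : ℝ} (hα : α < 1) (c : S → A → ℝ)
    (πδ : ℝ → S → ℝ) (d d' : S → A) {δ : ℝ} (hδ : δ ∈ Set.Icc (0 : ℝ) 1)
    (h0 : ∀ i, 0 ≤ πδ δ i) (h1 : ∑ i, πδ δ i = 1) {y₀ : ℝ}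
    (hlt : (∑ i, πδ δ i * ((1 - δ) * (if c i (d i) < y₀ then (1 : ℝ) else 0) +
      δ * (if c i (d' i) < y₀ then (1 : ℝ) else 0))) ≤ α)
    (hle : α ≤ ∑ i, πδ δ i * ((1 - δ) * (if c i (d i) ≤ y₀ then (1 : ℝ) else 0) +
      δ * (if c i (d' i) ≤ y₀ then (1 : ℝ) else 0))) (y : ℝ) :
    pCmix α c πδ d d' δ y₀ ≤ pCmix α c πδ d d' δ y := by
  let w : S ⊕ S → ℝ := Sum.elim (fun i => πδ δ i * (1 - δ)) fun i => πδ δ i * δ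
  let x : S ⊕ S → ℝ := Sum.elim (fun i => c i (d i)) fun i => c i (d' i)
  have hsum (f : ℝ → ℝ) : ∑ k, w k * f (x k) =
      ∑ i, πδ δ i * ((1 - δ) * f (c i (d i)) + δ * f (c i (d' i))) := by
    simp only [w, x, Fintype.sum_sum_type, Sum.elim_inl, Sum.elim_inr, mul_add,
      Finset.sum_add_distrib, mul_assoc]
  have hw0 : ∀ k, 0 ≤ w k := by
    rintro (i | i)
    · exact mul_nonneg (h0 i) (sub_nonneg.2 hδ.2)
    · exact mul_nonneg (h0 i) hδ.1
  have hw1 : ∑ k, w k = 1 := by simpa [h1] using hsum fun _ => 1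
  have := quantile_minimizes_pseudoCVaR w x hw0 hw1 hα (y₀ := y₀)
    ((hsum fun t => if t < y₀ then 1 else 0).trans_le hlt)
    (hle.trans_eq (hsum fun t => if t ≤ y₀ then 1 else 0).symm) y
  rwa [hsum fun t => y₀ + (1 - α)⁻¹ * max (t - y₀) 0,
    hsum fun t => y + (1 - α)⁻¹ * max (t - y) 0] at this

/-- The average cost of a stationary distribution is at least `V` when `V` is a
subsolution of the average cost inequality with bias `g`. -/
lemma le_sum_stationary_of_subsolution {S : Type*} [Fintype S] (P : S → S → ℝ)
    (μ f g : S → ℝ) (V : ℝ) (h0 : ∀ i, 0 ≤ μ i) (h1 : ∑ i, μ i = 1)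
    (hstat : ∀ j, ∑ i, μ i * P i j = μ j) (h : ∀ i, g i + V ≤ f i + ∑ j, P i j * g j) :
    V ≤ ∑ i, μ i * f i := by
  have hsum := Finset.sum_le_sum fun i (_ : i ∈ Finset.univ) =>
    mul_le_mul_of_nonneg_left (h i) (h0 i)
  have hswap : ∑ i, μ i * ∑ j, P i j * g j = ∑ j, μ j * g j := by
    simp only [Finset.mul_sum, ← mul_assoc]
    rw [Finset.sum_comm]
    simp only [← Finset.sum_mul, hstat]
  simp only [mul_add, Finset.sum_add_distrib, ← Finset.sum_mul, h1, one_mul, hswap] at hsum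
  linarith

/-- The Bellman local optimality condition implies local optimality of a
deterministic policy in the mixed policy space: there is an `ε > 0` such that mixing any
other deterministic policy with probability `δ ∈ [0, ε]` cannot decrease the long-run
CVaR. -/
theorem bellman_implies_local_optimality
    {S A : Type*} [Fintype S] [Fintype A] [Nonempty S] [Nonempty A]
    (p : S → A → S → ℝ) (hp0 : ∀ i a j, 0 ≤ p i a j) (hp1 : ∀ i a, ∑ j, p i a j = 1)
    (c : S → A → ℝ) (α : ℝ) (hα : α ∈ Set.Ioo (0 : ℝ) 1)
    (dstar : S → A) (πd : S → ℝ)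
    (hπd0 : ∀ i, 0 ≤ πd i) (hπd1 : ∑ i, πd i = 1)
    (hπdstat : ∀ j, ∑ i, πd i * p i (dstar i) j = πd j)
    (y₀ : ℝ) (hy₀ : y₀ = VaR α c πd dstar)
    (g : S → ℝ)
    (hg : ∀ i, g i = ctil α c y₀ i (dstar i) - pC α c πd dstar y₀ +
      ∑ j, p i (dstar i) j * g j)
    (hbellman : ∀ (i : S) (a : A),
      ctil α c y₀ i (dstar i) + (∑ j, p i (dstar i) j * g j) ≤
        ctil α c y₀ i a + ∑ j, p i a j * g j)
    (hnondeg :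
      (∑ i, if c i (dstar i) < y₀ then πd i else 0) < α ∧
      α < ∑ i, if c i (dstar i) ≤ y₀ then πd i else 0)
    (πmix : (S → A) → ℝ → S → ℝ)
    (hπmix0 : ∀ (d' : S → A), ∀ δ ∈ Set.Icc (0 : ℝ) 1, ∀ i, 0 ≤ πmix d' δ i)
    (hπmix1 : ∀ (d' : S → A), ∀ δ ∈ Set.Icc (0 : ℝ) 1, ∑ i, πmix d' δ i = 1)
    (hπmixstat : ∀ (d' : S → A), ∀ δ ∈ Set.Icc (0 : ℝ) 1, ∀ j,
      ∑ i, πmix d' δ i * ((1 - δ) * p i (dstar i) j + δ * p i (d' i) j) = πmix d' δ j)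
    (hπmixinit : ∀ d' : S → A, πmix d' 0 = πd)
    (hπmixcont : ∀ d' : S → A, ContinuousWithinAt (πmix d') (Set.Icc (0 : ℝ) 1) 0) :
    ∃ ε > (0 : ℝ), ∀ (d' : S → A), ∀ δ ∈ Set.Icc (0 : ℝ) ε,
      CV α c πd dstar ≤ CVmix α c (πmix d') dstar d' δ := by
  have hcont (d' : S → A) (f h : S → ℝ) : Filter.Tendsto
      (fun δ => ∑ i, πmix d' δ i * ((1 - δ) * f i + δ * h i))
      (nhdsWithin 0 (Set.Icc (0 : ℝ) 1)) (nhds (∑ i, πd i * f i)) := by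
    have : ContinuousWithinAt (fun δ => ∑ i, πmix d' δ i * ((1 - δ) * f i + δ * h i))
        (Set.Icc (0 : ℝ) 1) 0 := by
      have hi := continuousWithinAt_pi.1 (hπmixcont d')
      refine tendsto_finsetSum _ fun i _ => (hi i).mul ?_
      exact Continuous.continuousWithinAt (by fun_prop)
    simpa [ContinuousWithinAt, hπmixinit] using this
  have hev : ∀ᶠ δ in nhdsWithin 0 (Set.Icc (0 : ℝ) 1), ∀ d' : S → A,
      (∑ i, πmix d' δ i * ((1 - δ) * (if c i (dstar i) < y₀ then (1 : ℝ) else 0) +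
        δ * (if c i (d' i) < y₀ then (1 : ℝ) else 0))) < α ∧
      α < ∑ i, πmix d' δ i * ((1 - δ) * (if c i (dstar i) ≤ y₀ then (1 : ℝ) else 0) +
        δ * (if c i (d' i) ≤ y₀ then (1 : ℝ) else 0)) := by
    refine Filter.eventually_all.2 fun d' => ?_
    exact ((hcont d' _ _).eventually_lt_const (by simpa using hnondeg.1)).and
      ((hcont d' _ _).eventually_const_lt (by simpa using hnondeg.2))
  have hCV : CV α c πd dstar ≤ pC α c πd dstar y₀ := by
    refine csInf_le ⟨pC α c πd dstar y₀, ?_⟩ ⟨y₀, rfl⟩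
    rintro _ ⟨y, rfl⟩
    simpa [pCmix, pC] using pCmix_min_of_quantile hα.2 c (fun _ => πd) dstar dstar
      (δ := 0) (by simp) hπd0 hπd1 (y₀ := y₀) (by simpa using hnondeg.1.le)
      (by simpa using hnondeg.2.le) y
  obtain ⟨r, hr, hball⟩ := Metric.mem_nhdsWithin_iff.1 hev
  refine ⟨min (r / 2) 1, by positivity, fun d' δ hδ => ?_⟩
  have hδr : δ ≤ r / 2 := hδ.2.trans (min_le_left _ _)
  have hδ1 : δ ∈ Set.Icc (0 : ℝ) 1 := ⟨hδ.1, hδ.2.trans (min_le_right _ _)⟩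
  obtain ⟨hlt, hle⟩ := hball ⟨by
    rw [Metric.mem_ball, Real.dist_eq, sub_zero, abs_of_nonneg hδ.1]
    linarith, hδ1⟩ d'
  refine le_csInf (Set.range_nonempty _) ?_
  rintro _ ⟨y, rfl⟩
  refine hCV.trans (le_trans ?_ (pCmix_min_of_quantile hα.2 c (πmix d') dstar d' hδ1
    (hπmix0 d' δ hδ1) (hπmix1 d' δ hδ1) hlt.le hle.le y))
  refine le_sum_stationary_of_subsolution _ _ _ g _ (hπmix0 d' δ hδ1) (hπmix1 d' δ hδ1)
    (hπmixstat d' δ hδ1) fun i => ?_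
  have hsplit : ∑ j, ((1 - δ) * p i (dstar i) j + δ * p i (d' i) j) * g j =
      (1 - δ) * ∑ j, p i (dstar i) j * g j + δ * ∑ j, p i (d' i) j * g j := by
    simp only [add_mul, Finset.sum_add_distrib, Finset.mul_sum, mul_assoc]
  rw [hsplit]
  have := mul_le_mul_of_nonneg_left (hbellman i (d' i)) hδ1.1
  linear_combination this + hg i
end

section
/- Minimax equality for long-run CVaR maximization: let S, A be finite nonempty sets, p transition probabilities, c : S×A → ℝ, α ∈ (0,1). Let X := { x : S×A → ℝ : x(i,a) ≥ 0 for all (i,a), Σ_{i,a} x(i,a) = 1, and Σ_{a} x(i,a) = Σ_{j,a} x(j,a)·p(i|j,a) for all i ∈ S }, and assume X is nonempty. Let c̲ := min_{i,a} c(i,a), c̄ := max_{i,a} c(i,a), and f(x,y) := Σ_{i,a} x(i,a)·( y + (1-α)⁻¹·max(c(i,a) - y, 0) ). Then the maxima and minima below are attained and max_{x∈X} min_{y∈[c̲,c̄]} f(x,y) = min_{y∈[c̲,c̄]} max_{x∈X} f(x,y). -/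
/-- The Rockafellar–Uryasev objective `f(x,y) = Σ_{i,a} x(i,a) (y + (1-α)⁻¹ max(c(i,a)-y,0))`. -/
noncomputable def RUf {S A : Type*} [Fintype S] [Fintype A] (α : ℝ) (c : S → A → ℝ)
    (x : S × A → ℝ) (y : ℝ) : ℝ :=
  ∑ q : S × A, x q * (y + (1 - α)⁻¹ * max (c q.1 q.2 - y) 0)

/-- The polytope of stationary state-action occupation measures. -/
def occupationSet {S A : Type*} [Fintype S] [Fintype A] (p : S → A → S → ℝ) :
    Set (S × A → ℝ) :=
  {x | (∀ q : S × A, 0 ≤ x q) ∧ (∑ q : S × A, x q = 1) ∧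
    (∀ i : S, ∑ a : A, x (i, a) = ∑ j : S, ∑ a : A, x (j, a) * p j a i)}

/-- The occupation polytope is convex. -/
theorem convex_occupationSet {S A : Type*} [Fintype S] [Fintype A] (p : S → A → S → ℝ) :
    Convex ℝ (occupationSet p) := by
  rintro x ⟨hx0, hx1, hx⟩ y ⟨hy0, hy1, hy⟩ a b ha hb hab
  refine ⟨fun q => ?_, ?_, fun i => ?_⟩
  · have := mul_nonneg ha (hx0 q)
    have := mul_nonneg hb (hy0 q)
    simp only [Pi.add_apply, Pi.smul_apply, smul_eq_mul]
    linarith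
  · simp only [Pi.add_apply, Pi.smul_apply, smul_eq_mul, Finset.sum_add_distrib,
      ← Finset.mul_sum, hx1, hy1, mul_one, hab]
  · simp only [Pi.add_apply, Pi.smul_apply, smul_eq_mul, Finset.sum_add_distrib, add_mul,
      mul_assoc, ← Finset.mul_sum, hx i, hy i]

/-- The occupation polytope is compact. -/
theorem isCompact_occupationSet {S A : Type*} [Fintype S] [Fintype A] (p : S → A → S → ℝ) :
    IsCompact (occupationSet p) := by
  refine (isCompact_Icc (a := (0 : S × A → ℝ)) (b := 1)).of_isClosed_subset ?_ ?_
  · have h : IsClosed ({x : S × A → ℝ | ∀ q, 0 ≤ x q} ∩ ({x | ∑ q, x q = 1} ∩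
        {x | ∀ i, ∑ a, x (i, a) = ∑ j, ∑ a, x (j, a) * p j a i})) := by
      refine IsClosed.inter ?_ (IsClosed.inter ?_ ?_)
      · rw [Set.ofPred_forall]
        exact isClosed_iInter fun q => isClosed_le (by fun_prop) (by fun_prop)
      · exact isClosed_eq (by fun_prop) (by fun_prop)
      · rw [Set.ofPred_forall]
        exact isClosed_iInter fun i => isClosed_eq (by fun_prop) (by fun_prop)
    exact h
  · rintro x ⟨hx0, hx1, -⟩
    exact ⟨hx0, fun q =>
      (Finset.single_le_sum (fun r _ => hx0 r) (Finset.mem_univ q)).trans_eq hx1⟩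

theorem continuous_RUf_left {S A : Type*} [Fintype S] [Fintype A] (α : ℝ) (c : S → A → ℝ)
    (y : ℝ) : Continuous fun x => RUf α c x y := by
  unfold RUf
  fun_prop

theorem continuous_RUf_right {S A : Type*} [Fintype S] [Fintype A] (α : ℝ) (c : S → A → ℝ)
    (x : S × A → ℝ) : Continuous (RUf α c x) := by
  unfold RUf
  fun_prop

/-- The Rockafellar–Uryasev objective is linear, hence concave, in the occupation measure. -/
theorem concaveOn_RUf {S A : Type*} [Fintype S] [Fintype A] (α : ℝ) (c : S → A → ℝ)
    {X : Set (S × A → ℝ)} (hX : Convex ℝ X) (y : ℝ) :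
    ConcaveOn ℝ X fun x => RUf α c x y := by
  refine ⟨hX, fun x _ z _ a b _ _ _ => le_of_eq ?_⟩
  simp only [RUf, Pi.add_apply, Pi.smul_apply, smul_eq_mul, add_mul, Finset.sum_add_distrib,
    Finset.mul_sum, mul_assoc]

/-- The Rockafellar–Uryasev objective is convex in the threshold. -/
theorem convexOn_RUf {S A : Type*} [Fintype S] [Fintype A] {α : ℝ} (hα : α ≤ 1)
    (c : S → A → ℝ) {x : S × A → ℝ} (hx : ∀ q, 0 ≤ x q) {Y : Set ℝ} (hY : Convex ℝ Y) :
    ConvexOn ℝ Y (RUf α c x) := by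
  refine ⟨hY, fun y _ z _ a b ha hb hab => ?_⟩
  simp only [RUf, smul_eq_mul, Finset.mul_sum]
  rw [← Finset.sum_add_distrib]
  refine Finset.sum_le_sum fun q _ => ?_
  have hmax : max (c q.1 q.2 - (a * y + b * z)) 0 ≤
      a * max (c q.1 q.2 - y) 0 + b * max (c q.1 q.2 - z) 0 := by
    refine max_le ?_ (by positivity)
    calc c q.1 q.2 - (a * y + b * z) = a * (c q.1 q.2 - y) + b * (c q.1 q.2 - z) := by
          linear_combination (-c q.1 q.2) * hab
      _ ≤ _ := by gcongr <;> exact le_max_left _ _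
  have hk : 0 ≤ (1 - α)⁻¹ := inv_nonneg.2 (sub_nonneg.2 hα)
  calc x q * (a * y + b * z + (1 - α)⁻¹ * max (c q.1 q.2 - (a * y + b * z)) 0)
      ≤ x q * (a * y + b * z + (1 - α)⁻¹ *
          (a * max (c q.1 q.2 - y) 0 + b * max (c q.1 q.2 - z) 0)) := by
        have := hx q
        gcongr
    _ = _ := by ring

/-- Minimax equality for long-run CVaR maximization: the maxima and minima
are attained and `max_{x ∈ X} min_{y ∈ [c̲,c̄]} f(x,y) = min_{y ∈ [c̲,c̄]} max_{x ∈ X} f(x,y)`. -/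
theorem cvar_maximization_minimax
    {S A : Type*} [Fintype S] [Fintype A] [Nonempty S] [Nonempty A]
    (p : S → A → S → ℝ) (hp0 : ∀ i a j, 0 ≤ p i a j) (hp1 : ∀ i a, ∑ j, p i a j = 1)
    (c : S → A → ℝ) (α : ℝ) (hα : α ∈ Set.Ioo (0 : ℝ) 1)
    (hne : (occupationSet p).Nonempty)
    (clo chi : ℝ) (hclo : clo = ⨅ q : S × A, c q.1 q.2)
    (hchi : chi = ⨆ q : S × A, c q.1 q.2) :
    (∀ x ∈ occupationSet p, ∃ y ∈ Set.Icc clo chi,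
      RUf α c x y = sInf (RUf α c x '' Set.Icc clo chi)) ∧
    (∀ y ∈ Set.Icc clo chi, ∃ x ∈ occupationSet p,
      RUf α c x y = sSup ((fun x => RUf α c x y) '' occupationSet p)) ∧
    (∃ x₀ ∈ occupationSet p,
      sInf (RUf α c x₀ '' Set.Icc clo chi) =
        sSup ((fun x => sInf (RUf α c x '' Set.Icc clo chi)) '' occupationSet p)) ∧
    (∃ y₀ ∈ Set.Icc clo chi,
      sSup ((fun x => RUf α c x y₀) '' occupationSet p) =
        sInf ((fun y => sSup ((fun x => RUf α c x y) '' occupationSet p)) ''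
          Set.Icc clo chi)) ∧
    sSup ((fun x => sInf (RUf α c x '' Set.Icc clo chi)) '' occupationSet p) =
      sInf ((fun y => sSup ((fun x => RUf α c x y) '' occupationSet p)) ''
        Set.Icc clo chi) := by
  have hX := isCompact_occupationSet p
  have hle : clo ≤ chi := by
    subst hclo hchi
    exact ciInf_le_ciSup (Set.finite_range _).bddBelow (Set.finite_range _).bddAbove
  have hY : (Set.Icc clo chi).Nonempty := Set.nonempty_Icc.2 hle
  have hcx (x) : ContinuousOn (RUf α c x) (Set.Icc clo chi) :=
    (continuous_RUf_right α c x).continuousOn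
  have hcy (y) : ContinuousOn (fun x => RUf α c x y) (occupationSet p) :=
    (continuous_RUf_left α c y).continuousOn
  obtain ⟨y₀, hy₀, x₀, hx₀, hs⟩ := Sion.exists_isSaddlePointOn (f := fun y x => RUf α c x y)
    hY (convex_Icc clo chi) isCompact_Icc
    (fun x _ => (hcx x).lowerSemicontinuousOn)
    (fun x hx => (convexOn_RUf hα.2.le c hx.1 (convex_Icc clo chi)).quasiconvexOn)
    (convex_occupationSet p) hne hX
    (fun y _ => (hcy y).upperSemicontinuousOn)
    (fun y _ => (concaveOn_RUf α c (convex_occupationSet p) y).quasiconcaveOn)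
  have hinf : sInf (RUf α c x₀ '' Set.Icc clo chi) = RUf α c x₀ y₀ :=
    IsLeast.csInf_eq ⟨⟨y₀, hy₀, rfl⟩, by rintro _ ⟨y, hy, rfl⟩; exact hs y hy x₀ hx₀⟩
  have hsup : sSup ((fun x => RUf α c x y₀) '' occupationSet p) = RUf α c x₀ y₀ :=
    IsGreatest.csSup_eq ⟨⟨x₀, hx₀, rfl⟩, by rintro _ ⟨x, hx, rfl⟩; exact hs y₀ hy₀ x hx⟩
  have hsupinf : sSup ((fun x => sInf (RUf α c x '' Set.Icc clo chi)) '' occupationSet p) =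
      RUf α c x₀ y₀ := by
    refine IsGreatest.csSup_eq ⟨⟨x₀, hx₀, hinf⟩, ?_⟩
    rintro _ ⟨x, hx, rfl⟩
    exact (csInf_le (isCompact_Icc.bddBelow_image (hcx x)) ⟨y₀, hy₀, rfl⟩).trans
      (hs y₀ hy₀ x hx)
  have hinfsup : sInf ((fun y => sSup ((fun x => RUf α c x y) '' occupationSet p)) ''
      Set.Icc clo chi) = RUf α c x₀ y₀ := by
    refine IsLeast.csInf_eq ⟨⟨y₀, hy₀, hsup⟩, ?_⟩
    rintro _ ⟨y, hy, rfl⟩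
    exact (hs y hy x₀ hx₀).trans (le_csSup (hX.bddAbove_image (hcy y)) ⟨x₀, hx₀, rfl⟩)
  refine ⟨fun x _ => ?_, fun y _ => ?_, ⟨x₀, hx₀, hinf.trans hsupinf.symm⟩,
    ⟨y₀, hy₀, hsup.trans hinfsup.symm⟩, hsupinf.trans hinfsup.symm⟩
  · obtain ⟨y, hy, h⟩ := isCompact_Icc.exists_sInf_image_eq hY (hcx x)
    exact ⟨y, hy, h.symm⟩
  · obtain ⟨x, hx, h⟩ := hX.exists_sSup_image_eq hne (hcy y)
    exact ⟨x, hx, h.symm⟩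
end
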